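/- For every s > 2 and every two-dimensional lattice L of co-volume 1, ζ_L(s) ≥ ζ_{A₂}(s), with equality if and only if L = O·A₂ for some orthogonal transformation O of ℝ²; that is, the triangular lattice A₂ is the unique minimizer of L ↦ ζ_L(s) among lattices of co-volume 1, up to rotation. -/

import Mathlib

noncomputable section

/-- A point of the Euclidean plane with coordinates `a`, `b`. -/
def vec2 (a b : ℝ) : EuclideanSpace ℝ (Fin 2) := (WithLp.equiv 2 (Fin 2 → ℝ)).symm ![a, b]

/-- The lattice (as a set of points) generated by `u` and `v`. -/
def latticeSet (u v : EuclideanSpace ℝ (Fin 2)) : Set (EuclideanSpace ℝ (Fin 2)) :=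
  {p | ∃ m n : ℤ, p = (m : ℝ) • u + (n : ℝ) • v}

/-- The determinant of the pair of plane vectors `(u, v)`. -/
def det2 (u v : EuclideanSpace ℝ (Fin 2)) : ℝ := u 0 * v 1 - u 1 * v 0

/-- `L` is a two-dimensional lattice, i.e. `L = ℤu ⊕ ℤv` for a basis `(u,v)` of ℝ². -/
def IsLattice2 (L : Set (EuclideanSpace ℝ (Fin 2))) : Prop :=
  ∃ u v : EuclideanSpace ℝ (Fin 2), det2 u v ≠ 0 ∧ L = latticeSet u v

/-- `L` is a two-dimensional lattice of co-volume `V = |det(u,v)|`. -/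
def IsLattice2OfCovol (L : Set (EuclideanSpace ℝ (Fin 2))) (V : ℝ) : Prop :=
  ∃ u v : EuclideanSpace ℝ (Fin 2), det2 u v ≠ 0 ∧ |det2 u v| = V ∧ L = latticeSet u v

/-- The Epstein zeta function of a set of points: `ζ_L(s) = Σ'_{p ∈ L, p ≠ 0} |p|^{-s}`. -/
def epsteinZeta (L : Set (EuclideanSpace ℝ (Fin 2))) (s : ℝ) : ℝ :=
  ∑' p : ↥(L \ {0}), ‖(p : EuclideanSpace ℝ (Fin 2))‖ ^ (-s)

/-- The Lennard-Jones type energy `E_f[L] = Σ'_{p ∈ L, p ≠ 0} (a|p|^{-α} - b|p|^{-β})`. -/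
def LJenergy (a b α β : ℝ) (L : Set (EuclideanSpace ℝ (Fin 2))) : ℝ :=
  ∑' p : ↥(L \ {0}),
    (a * ‖(p : EuclideanSpace ℝ (Fin 2))‖ ^ (-α) - b * ‖(p : EuclideanSpace ℝ (Fin 2))‖ ^ (-β))

/-- The triangular lattice `A₂ = √(2/√3)·[ℤ(1,0) ⊕ ℤ(1/2,√3/2)]`, of co-volume 1. -/
def triangularLattice : Set (EuclideanSpace ℝ (Fin 2)) :=
  latticeSet (Real.sqrt (2 / Real.sqrt 3) • vec2 1 0)
    (Real.sqrt (2 / Real.sqrt 3) • vec2 (1 / 2) (Real.sqrt 3 / 2))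

/-- The square lattice `ℤ² = ℤ(1,0) ⊕ ℤ(0,1)`. -/
def squareLattice : Set (EuclideanSpace ℝ (Fin 2)) := latticeSet (vec2 1 0) (vec2 0 1)

/-- `L` is the image of `L'` under an orthogonal transformation of ℝ². -/
def IsRotationOf (L L' : Set (EuclideanSpace ℝ (Fin 2))) : Prop :=
  ∃ O : EuclideanSpace ℝ (Fin 2) ≃ₗᵢ[ℝ] EuclideanSpace ℝ (Fin 2), L = O '' L'

/-- The unit co-volume lattice parametrized by `(x, y)` in the half-fundamental domain:
`ℤu ⊕ ℤv` with `u = (1/√y, 0)` and `v = (x/√y, √y)`. -/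
def latticeXY (x y : ℝ) : Set (EuclideanSpace ℝ (Fin 2)) :=
  latticeSet (vec2 (1 / Real.sqrt y) 0) (vec2 (x / Real.sqrt y) (Real.sqrt y))

/-- The Riemann zeta function `ζ(s) = Σ_{m ≥ 1} m^{-s}` (real variable version). -/
def riemannZetaReal (s : ℝ) : ℝ := ∑' n : ℕ+, (n : ℝ) ^ (-s)

end

/-- The quadratic form `|m + n z|² / im z` at `z = x + i y`, of determinant one. -/
noncomputable def quadForm (x y : ℝ) (p : ℤ × ℤ) : ℝ :=
  (((p.1 : ℝ) + p.2 * x) ^ 2 + (p.2 * y) ^ 2) / y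

/-- The theta function of the form `quadForm x y`. -/
noncomputable def latticeTheta (t x y : ℝ) : ℝ :=
  ∑' p : ℤ × ℤ, Real.exp (-(Real.pi * t * quadForm x y p))

lemma summable_exp_neg_mul_int_sq {a : ℝ} (ha : 0 < a) :
    Summable fun n : ℤ => Real.exp (-(a * (n : ℝ) ^ 2)) := by
  have h : Summable fun n : ℕ => Real.exp (-a) ^ n :=
    summable_geometric_of_lt_one (Real.exp_pos _).le (by simpa using ha)
  have key : ∀ n : ℕ, Real.exp (-(a * (n : ℝ) ^ 2)) ≤ Real.exp (-a) ^ n := by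
    intro n
    rw [← Real.exp_nat_mul, Real.exp_le_exp]
    have : (n : ℝ) ≤ (n : ℝ) ^ 2 := by exact_mod_cast Nat.le_self_pow two_ne_zero n
    nlinarith
  have h' := Summable.of_nonneg_of_le (fun n => (Real.exp_pos _).le) key h
  refine Summable.of_nat_of_neg ?_ ?_ <;> simpa using h'

lemma summable_exp_neg_mul_exp_neg {a b : ℝ} (ha : 0 < a) (hb : 0 < b) :
    Summable fun p : ℤ × ℤ =>
      Real.exp (-(a * (p.1 : ℝ) ^ 2)) * Real.exp (-(b * (p.2 : ℝ) ^ 2)) :=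
  (summable_exp_neg_mul_int_sq ha).mul_of_nonneg (summable_exp_neg_mul_int_sq hb)
    (fun _ => (Real.exp_pos _).le) (fun _ => (Real.exp_pos _).le)

lemma summable_latticeTheta {t y : ℝ} (x : ℝ) (ht : 0 < t) (hy : 0 < y) :
    Summable fun p : ℤ × ℤ => Real.exp (-(Real.pi * t * quadForm x y p)) := by
  set C : ℝ := 2 + (2 * x ^ 2 + 1) / y ^ 2 with hC
  have hC0 : 0 < C := by positivity
  have hlam : 0 < Real.pi * t / (y * C) := by positivity
  refine Summable.of_nonneg_of_le (fun _ => (Real.exp_pos _).le) (fun p => ?_)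
    (summable_exp_neg_mul_exp_neg hlam hlam)
  rw [← Real.exp_add, Real.exp_le_exp]
  have h1 : (p.1 : ℝ) ^ 2 + (p.2 : ℝ) ^ 2
      ≤ C * (((p.1 : ℝ) + p.2 * x) ^ 2 + (p.2 * y) ^ 2) := by
    have e : (2 * x ^ 2 + 1) / y ^ 2 * (p.2 * y) ^ 2 = (2 * x ^ 2 + 1) * (p.2 : ℝ) ^ 2 := by
      field_simp
    have h2 : 0 ≤ (2 * x ^ 2 + 1) / y ^ 2 * ((p.1 : ℝ) + p.2 * x) ^ 2 := by positivity
    rw [hC]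
    nlinarith [sq_nonneg ((p.1 : ℝ) + 2 * (p.2 * x)), sq_nonneg ((p.2 : ℝ) * y)]
  have h3 : Real.pi * t / (y * C) * (p.1 : ℝ) ^ 2 + Real.pi * t / (y * C) * (p.2 : ℝ) ^ 2
      ≤ Real.pi * t * quadForm x y p := by
    calc _ = Real.pi * t / (y * C) * ((p.1 : ℝ) ^ 2 + (p.2 : ℝ) ^ 2) := by ring
      _ ≤ Real.pi * t / (y * C) * (C * (((p.1 : ℝ) + p.2 * x) ^ 2 + (p.2 * y) ^ 2)) := by gcongr
      _ = _ := by unfold quadForm; field_simp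
  linarith

lemma tsum_exp_neg_int_add_sq {c : ℝ} (hc : 0 < c) (b : ℝ) :
    ∑' m : ℤ, Real.exp (-(Real.pi * c * ((m : ℝ) + b) ^ 2)) =
      √(1 / c) * ∑' k : ℤ, Real.exp (-(Real.pi * (1 / c) * (k : ℝ) ^ 2)) *
        Real.cos (2 * Real.pi * k * b) := by
  have h := Complex.tsum_exp_neg_quadratic (a := ((1 / c : ℝ) : ℂ))
    (by rw [Complex.ofReal_re]; positivity) (-Complex.I * b)
  have e1 : ∀ n : ℤ, Complex.exp (-Real.pi / ((1 / c : ℝ) : ℂ) *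
      (n + Complex.I * (-Complex.I * b)) ^ 2)
      = ((Real.exp (-(Real.pi * c * ((n : ℝ) + b) ^ 2)) : ℝ) : ℂ) := by
    intro n
    push_cast
    congr 1
    have : (c : ℂ) ≠ 0 := by exact_mod_cast hc.ne'
    field_simp
    rw [show (n : ℂ) + -(Complex.I ^ 2 * b) = n + b by rw [Complex.I_sq]; ring]
  have e0 : ∀ n : ℤ, -Real.pi * ((1 / c : ℝ) : ℂ) * n ^ 2 + 2 * Real.pi * (-Complex.I * b) * n
      = ((-(Real.pi * (1 / c) * (n : ℝ) ^ 2) : ℝ) : ℂ)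
        + ((-(2 * Real.pi * n * b) : ℝ) : ℂ) * Complex.I := by
    intro n
    push_cast
    ring
  have e2 : ∀ n : ℤ, (Complex.exp (-Real.pi * ((1 / c : ℝ) : ℂ) * n ^ 2 +
      2 * Real.pi * (-Complex.I * b) * n)).re
      = Real.exp (-(Real.pi * (1 / c) * (n : ℝ) ^ 2)) * Real.cos (2 * Real.pi * n * b) := by
    intro n
    rw [e0, Complex.exp_re]
    simp only [Complex.add_re, Complex.ofReal_re, Complex.mul_re, Complex.I_re, mul_zero,
      Complex.ofReal_im, Complex.I_im, mul_one, sub_self, add_zero, Complex.add_im,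
      Complex.mul_im, zero_add, Real.cos_neg]
  have hs : Summable fun n : ℤ => Complex.exp (-Real.pi * ((1 / c : ℝ) : ℂ) * n ^ 2 +
      2 * Real.pi * (-Complex.I * b) * n) := by
    refine Summable.of_norm ?_
    have hp : 0 < Real.pi * (1 / c) := by positivity
    refine (summable_exp_neg_mul_int_sq hp).congr fun n => ?_
    rw [Complex.norm_exp, e0]
    simp only [Complex.add_re, Complex.ofReal_re, Complex.mul_re, Complex.I_re, mul_zero,
      Complex.ofReal_im, Complex.I_im, mul_one, sub_self, add_zero]
  rw [tsum_congr e1, ← Complex.ofReal_tsum] at h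
  have hsq : ((1 / c : ℝ) : ℂ) ^ (1 / 2 : ℂ) = ((√(1 / c) : ℝ) : ℂ) := by
    rw [Real.sqrt_eq_rpow, Complex.ofReal_cpow (by positivity)]
    norm_num
  rw [hsq] at h
  have h' := congrArg Complex.re h
  rw [Complex.re_tsum hs, tsum_congr e2, show (1 : ℂ) / ((√(1 / c) : ℝ) : ℂ)
    = ((1 / √(1 / c) : ℝ) : ℂ) by push_cast; ring, Complex.re_ofReal_mul, Complex.ofReal_re] at h'
  have : √(1 / c) ≠ 0 := by positivity
  rw [h']
  field_simp

lemma summable_exp_mul_exp_mul_cos {a b : ℝ} (ha : 0 < a) (hb : 0 < b) (x : ℝ) :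
    Summable fun p : ℤ × ℤ => Real.exp (-(a * (p.1 : ℝ) ^ 2)) * Real.exp (-(b * (p.2 : ℝ) ^ 2)) *
      Real.cos (2 * Real.pi * p.1 * p.2 * x) := by
  refine Summable.of_norm_bounded (summable_exp_neg_mul_exp_neg ha hb) fun p => ?_
  rw [norm_mul, Real.norm_of_nonneg (by positivity)]
  exact mul_le_of_le_one_right (by positivity) (Real.abs_cos_le_one _)

lemma latticeTheta_eq_iterated {t y : ℝ} (x : ℝ) (ht : 0 < t) (hy : 0 < y) :
    latticeTheta t x y = ∑' n : ℤ, Real.exp (-(Real.pi * t * y * (n : ℝ) ^ 2)) *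
      ∑' m : ℤ, Real.exp (-(Real.pi * (t / y) * ((m : ℝ) + n * x) ^ 2)) := by
  have hs := summable_latticeTheta x ht hy
  rw [latticeTheta, ← (Equiv.prodComm ℤ ℤ).tsum_eq]
  have hs' := (Equiv.prodComm ℤ ℤ).summable_iff.mpr hs
  refine hs'.tsum_prod.trans (tsum_congr fun n => ?_)
  simp only [Function.comp_apply]
  rw [← tsum_mul_left]
  refine tsum_congr fun m => ?_
  rw [← Real.exp_add]
  congr 1
  simp only [quadForm, Equiv.prodComm_apply, Prod.swap_prod_mk]
  field_simp
  ring

lemma latticeTheta_eq_fourier {t y : ℝ} (x : ℝ) (ht : 0 < t) (hy : 0 < y) :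
    latticeTheta t x y = √(y / t) * ∑' p : ℤ × ℤ,
      Real.exp (-(Real.pi * (y / t) * (p.1 : ℝ) ^ 2)) *
      Real.exp (-(Real.pi * t * y * (p.2 : ℝ) ^ 2)) * Real.cos (2 * Real.pi * p.1 * p.2 * x) := by
  have hs := summable_exp_mul_exp_mul_cos (a := Real.pi * (y / t)) (b := Real.pi * t * y)
    (by positivity) (by positivity) x
  have hs' := (Equiv.prodComm ℤ ℤ).summable_iff.mpr hs
  rw [latticeTheta_eq_iterated x ht hy, ← (Equiv.prodComm ℤ ℤ).tsum_eq]
  refine Eq.trans ?_ (congrArg _ hs'.tsum_prod.symm)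
  rw [← tsum_mul_left]
  refine tsum_congr fun n => ?_
  simp only [Function.comp_apply]
  rw [tsum_exp_neg_int_add_sq (by positivity), ← tsum_mul_left, ← tsum_mul_left, ← tsum_mul_left,
    one_div_div]
  refine tsum_congr fun k => ?_
  simp only [Equiv.prodComm_apply, Prod.swap_prod_mk]
  rw [show 2 * Real.pi * (k : ℝ) * (n * x) = 2 * Real.pi * k * n * x by ring]
  ring

/-- The functional equation of the theta function of a form of determinant one. -/
lemma latticeTheta_one_div {t y : ℝ} (x : ℝ) (ht : 0 < t) (hy : 0 < y) :
    latticeTheta (1 / t) x y = t * latticeTheta t x y := by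
  rw [latticeTheta_eq_fourier x ht hy, latticeTheta_eq_fourier x (by positivity) hy,
    ← (Equiv.prodComm ℤ ℤ).tsum_eq, ← mul_assoc]
  congr 1
  · rw [show y / (1 / t) = t ^ 2 * (y / t) by field_simp, Real.sqrt_mul (by positivity),
      Real.sqrt_sq ht.le]
  · refine tsum_congr fun p => ?_
    simp only [Equiv.prodComm_apply, Prod.fst_swap, Prod.snd_swap]
    rw [show Real.pi * (y / (1 / t)) = Real.pi * t * y by field_simp,
      show Real.pi * (1 / t) * y = Real.pi * (y / t) by field_simp,
      show 2 * Real.pi * (p.2 : ℝ) * p.1 * x = 2 * Real.pi * p.1 * p.2 * x by ring]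
    ring

lemma sq_mul_exp_neg_mul_sq_le {a : ℝ} (n : ℕ) (ha : 0 < a) :
    ((n : ℝ) + 1) ^ 2 * Real.exp (-(a * ((n : ℝ) + 1) ^ 2)) ≤
      Real.exp (-a) * (4 * Real.exp (-a) ^ 3) ^ n := by
  have h1 : ((n : ℝ) + 1) ^ 2 ≤ 4 ^ n := by
    have : n + 1 ≤ 2 ^ n := Nat.lt_two_pow_self
    have h : ((n : ℝ) + 1) ≤ 2 ^ n := by exact_mod_cast this
    calc ((n : ℝ) + 1) ^ 2 ≤ (2 ^ n) ^ 2 := by gcongr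
      _ = 4 ^ n := by rw [← pow_mul, mul_comm, pow_mul]; norm_num
  have h2 : Real.exp (-(a * ((n : ℝ) + 1) ^ 2)) ≤ Real.exp (-a) * (Real.exp (-a) ^ 3) ^ n := by
    rw [← pow_mul, ← Real.exp_nat_mul, ← Real.exp_add, Real.exp_le_exp]
    push_cast
    have : (n : ℝ) ≤ (n : ℝ) ^ 2 := by exact_mod_cast Nat.le_self_pow two_ne_zero n
    nlinarith
  calc _ ≤ 4 ^ n * (Real.exp (-a) * (Real.exp (-a) ^ 3) ^ n) := by gcongr
    _ = _ := by rw [mul_pow]; ring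

lemma hasSum_int_sq_mul_exp {a : ℝ} (ha : 0 < a) (h : Real.exp (-a) ≤ 1 / 4) :
    ∃ S : ℝ, HasSum (fun n : ℤ => (n : ℝ) ^ 2 * Real.exp (-(a * (n : ℝ) ^ 2))) S ∧
      0 ≤ S ∧ S ≤ 2 * Real.exp (-a) / (1 - 4 * Real.exp (-a) ^ 3) ∧
      S ≤ 32 / 15 * Real.exp (-a) := by
  have hE := Real.exp_pos (-a)
  have h4 : 4 * Real.exp (-a) ^ 3 ≤ 1 / 16 := by
    calc _ ≤ 4 * (1 / 4 : ℝ) ^ 3 := by gcongr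
      _ = _ := by norm_num
  have hg := (hasSum_geometric_of_lt_one (by positivity)
    (by linarith : 4 * Real.exp (-a) ^ 3 < 1)).mul_left (Real.exp (-a))
  have hs : Summable fun n : ℕ => ((n : ℝ) + 1) ^ 2 * Real.exp (-(a * ((n : ℝ) + 1) ^ 2)) :=
    Summable.of_nonneg_of_le (fun n => by positivity)
      (fun n => sq_mul_exp_neg_mul_sq_le n ha) hg.summable
  have hle := hasSum_le (fun n => sq_mul_exp_neg_mul_sq_le n ha) hs.hasSum hg
  set T := ∑' n : ℕ, ((n : ℝ) + 1) ^ 2 * Real.exp (-(a * ((n : ℝ) + 1) ^ 2)) with hT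
  have hT0 : 0 ≤ T := tsum_nonneg fun n => by positivity
  have hZ : HasSum (fun n : ℤ => (n : ℝ) ^ 2 * Real.exp (-(a * (n : ℝ) ^ 2))) (T + T) := by
    have h0 : HasSum (fun n : ℕ => (((n : ℤ) : ℝ)) ^ 2 *
        Real.exp (-(a * (((n : ℤ) : ℝ)) ^ 2))) T := by
      rw [← hasSum_nat_add_iff' 1]
      simpa using hs.hasSum
    refine HasSum.of_nat_of_neg_add_one h0 ?_
    convert hs.hasSum using 2 with n
    push_cast
    rw [neg_sq]
  have h1 : T + T ≤ 2 * Real.exp (-a) / (1 - 4 * Real.exp (-a) ^ 3) := by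
    rw [mul_div_assoc, div_eq_mul_inv]
    linarith
  refine ⟨_, hZ, by positivity, h1, h1.trans ?_⟩
  rw [div_le_iff₀ (by linarith)]
  nlinarith

lemma abs_sin_nat_mul_le (n : ℕ) (x : ℝ) : |Real.sin (n * x)| ≤ n * |Real.sin x| := by
  induction n with
  | zero => simp
  | succ k ih =>
    push_cast
    rw [add_mul, one_mul, Real.sin_add]
    calc _ ≤ |Real.sin (k * x) * Real.cos x| + |Real.cos (k * x) * Real.sin x| := abs_add_le _ _
      _ ≤ |Real.sin (k * x)| * 1 + 1 * |Real.sin x| := by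
        rw [abs_mul, abs_mul]
        gcongr
        · exact Real.abs_cos_le_one _
        · exact Real.abs_cos_le_one _
      _ ≤ _ := by linarith

lemma sin_int_mul_sq_le (n : ℤ) (x : ℝ) :
    Real.sin (n * x) ^ 2 ≤ (n : ℝ) ^ 2 * Real.sin x ^ 2 := by
  have h : Real.sin (n * x) ^ 2 = Real.sin ((n.natAbs : ℝ) * x) ^ 2 := by
    rcases Int.natAbs_eq n with h | h
    · conv_lhs => rw [h]
      simp
    · conv_lhs => rw [h]
      simp [Real.sin_neg]
  have h' : (n : ℝ) ^ 2 = (n.natAbs : ℝ) ^ 2 := by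
    rw [Nat.cast_natAbs, Int.cast_abs, sq_abs]
  rw [h, h', ← mul_pow, sq_le_sq, abs_mul, Nat.abs_cast]
  exact abs_sin_nat_mul_le _ _

/-- Comparison of `cos (2πNx)` with its value at `x = 1/2`. -/
lemma neg_two_mul_sq_mul_cos_sq_le (N : ℤ) (x : ℝ) :
    -(2 * (N : ℝ) ^ 2 * Real.cos (Real.pi * x) ^ 2) ≤
      Real.cos (2 * Real.pi * N * x) - Real.cos (2 * Real.pi * N * (1 / 2)) := by
  rcases Int.even_or_odd' N with ⟨j, hj | hj⟩
  · have h1 : Real.cos (2 * Real.pi * N * (1 / 2)) = 1 := by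
      rw [show 2 * Real.pi * (N : ℝ) * (1 / 2) = (j : ℝ) * (2 * Real.pi) by
        rw [hj]; push_cast; ring]
      exact Real.cos_int_mul_two_pi j
    have h2 : Real.cos (2 * Real.pi * N * x) =
        Real.cos (2 * (N * (Real.pi / 2 - Real.pi * x))) := by
      rw [show 2 * ((N : ℝ) * (Real.pi / 2 - Real.pi * x)) =
        (j : ℝ) * (2 * Real.pi) - 2 * Real.pi * N * x by rw [hj]; push_cast; ring,
        Real.cos_int_mul_two_pi_sub]
    have h3 := sin_int_mul_sq_le N (Real.pi / 2 - Real.pi * x)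
    rw [Real.sin_pi_div_two_sub] at h3
    rw [h1, h2, Real.cos_two_mul, Real.cos_sq' (N * _)]
    linarith
  · have h1 : Real.cos (2 * Real.pi * N * (1 / 2)) = -1 := by
      rw [show 2 * Real.pi * (N : ℝ) * (1 / 2) = (j : ℝ) * (2 * Real.pi) + Real.pi by
        rw [hj]; push_cast; ring]
      exact Real.cos_int_mul_two_pi_add_pi j
    rw [h1]
    have := Real.neg_one_le_cos (2 * Real.pi * N * x)
    have : 0 ≤ 2 * (N : ℝ) ^ 2 * Real.cos (Real.pi * x) ^ 2 := by positivity
    linarith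

lemma two_mul_cos_sq_eq {N : ℤ} (hN : N = 1 ∨ N = -1) (x : ℝ) :
    Real.cos (2 * Real.pi * N * x) - Real.cos (2 * Real.pi * N * (1 / 2)) =
      2 * Real.cos (Real.pi * x) ^ 2 := by
  have key : Real.cos (2 * Real.pi * x) - Real.cos (2 * Real.pi * (1 / 2)) =
      2 * Real.cos (Real.pi * x) ^ 2 := by
    rw [show 2 * Real.pi * (1 / 2) = Real.pi by ring, Real.cos_pi, mul_assoc, Real.cos_two_mul]
    ring
  rcases hN with rfl | rfl
  · simpa using key
  · rw [← key, ← Real.cos_neg, ← Real.cos_neg (2 * Real.pi * ((-1 : ℤ) : ℝ) * (1 / 2))]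
    push_cast
    congr 2 <;> ring

lemma latticeTheta_half_lt_of_exp_le {t x y : ℝ} (ht : 0 < t) (hy : 0 < y)
    (h1 : Real.exp (-(Real.pi * (y / t))) ≤ 1 / 4) (h2 : Real.exp (-(Real.pi * t * y)) ≤ 1 / 4)
    (hx : Real.cos (Real.pi * x) ≠ 0) :
    latticeTheta t (1 / 2) y < latticeTheta t x y := by
  rw [latticeTheta_eq_fourier x ht hy, latticeTheta_eq_fourier (1 / 2) ht hy]
  have ha : 0 < Real.pi * (y / t) := by positivity
  have hb : 0 < Real.pi * t * y := by positivity
  set a := Real.pi * (y / t)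
  set b := Real.pi * t * y
  refine mul_lt_mul_of_pos_left ?_ (by positivity)
  rw [← sub_pos, ← (summable_exp_mul_exp_mul_cos ha hb x).tsum_sub
    (summable_exp_mul_exp_mul_cos ha hb (1 / 2))]
  obtain ⟨S, hS, hS0, -, hSle⟩ := hasSum_int_sq_mul_exp ha h1
  obtain ⟨T, hT, hT0, -, hTle⟩ := hasSum_int_sq_mul_exp hb h2
  have hST : HasSum (fun p : ℤ × ℤ => ((p.1 : ℝ) ^ 2 * Real.exp (-(a * (p.1 : ℝ) ^ 2))) *
      ((p.2 : ℝ) ^ 2 * Real.exp (-(b * (p.2 : ℝ) ^ 2)))) (S * T) :=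
    hS.mul hT (hS.summable.mul_of_nonneg hT.summable (fun _ => by positivity)
      (fun _ => by positivity))
  set A : Finset (ℤ × ℤ) := {((1 : ℤ), (1 : ℤ)), (1, -1), (-1, 1), (-1, -1)} with hA
  have hc := hasSum_sum_of_ne_finset_zero (L := SummationFilter.unconditional _)
    (f := fun p : ℤ × ℤ => if p ∈ A then
    2 * (Real.exp (-a) * Real.exp (-b)) else 0) (s := A) (fun p hp => if_neg hp)
  have hcv : ∑ p ∈ A, (if p ∈ A then 2 * (Real.exp (-a) * Real.exp (-b)) else 0)
      = 8 * (Real.exp (-a) * Real.exp (-b)) := by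
    rw [Finset.sum_ite_mem, Finset.inter_self, Finset.sum_const,
      show A.card = 4 by rw [hA]; decide]
    simp; ring
  rw [hcv] at hc
  have hlow := (hc.sub hST).mul_left (2 * Real.cos (Real.pi * x) ^ 2)
  have hle := hasSum_le (fun p => ?_) hlow ((summable_exp_mul_exp_mul_cos ha hb x).sub
    (summable_exp_mul_exp_mul_cos ha hb (1 / 2))).hasSum
  · refine lt_of_lt_of_le (mul_pos (by positivity) ?_) hle
    have ea := Real.exp_pos (-a)
    have eb := Real.exp_pos (-b)
    have : S * T ≤ (32 / 15 * Real.exp (-a)) * (32 / 15 * Real.exp (-b)) := by gcongr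
    nlinarith [mul_pos ea eb]
  · have e1 : ∀ z : ℝ, 2 * Real.pi * (p.1 : ℝ) * p.2 * z =
        2 * Real.pi * ((p.1 * p.2 : ℤ) : ℝ) * z := by
      intro z; push_cast; ring
    rw [← mul_sub, e1, e1]
    by_cases hp : p ∈ A
    · have hv : ((p.1 : ℝ) ^ 2 = 1 ∧ (p.2 : ℝ) ^ 2 = 1) ∧ (p.1 * p.2 = 1 ∨ p.1 * p.2 = -1) := by
        simp only [hA, Finset.mem_insert, Finset.mem_singleton] at hp
        rcases hp with rfl | rfl | rfl | rfl <;> norm_num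
      rw [if_pos hp, two_mul_cos_sq_eq hv.2, hv.1.1, hv.1.2, mul_one, mul_one]
      apply le_of_eq
      ring
    · rw [if_neg hp]
      have h := neg_two_mul_sq_mul_cos_sq_le (p.1 * p.2) x
      have h' := mul_le_mul_of_nonneg_left h
        (by positivity : 0 ≤ Real.exp (-(a * (p.1 : ℝ) ^ 2)) * Real.exp (-(b * (p.2 : ℝ) ^ 2)))
      refine le_trans (le_of_eq ?_) h'
      push_cast
      ring

/-- The one-dimensional theta sum over the translate `b + ℤ`. -/
noncomputable def gaussSum1 (p b : ℝ) : ℝ := ∑' m : ℤ, Real.exp (-(p * ((m : ℝ) + b) ^ 2))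

lemma summable_exp_neg_int_add_sq {p : ℝ} (hp : 0 < p) (b : ℝ) :
    Summable fun m : ℤ => Real.exp (-(p * ((m : ℝ) + b) ^ 2)) := by
  refine Summable.of_nonneg_of_le (fun _ => (Real.exp_pos _).le) (fun m => ?_)
    ((summable_exp_neg_mul_int_sq (half_pos hp)).mul_left (Real.exp (p * b ^ 2)))
  rw [← Real.exp_add, Real.exp_le_exp]
  nlinarith [mul_nonneg hp.le (sq_nonneg ((m : ℝ) + 2 * b))]

lemma gaussSum1_add_int (p b : ℝ) (k : ℤ) : gaussSum1 p (b + k) = gaussSum1 p b := by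
  unfold gaussSum1
  rw [← (Equiv.addRight (-k)).tsum_eq]
  refine tsum_congr fun m => ?_
  congr 3
  simp
  ring

lemma gaussSum1_neg (p b : ℝ) : gaussSum1 p (-b) = gaussSum1 p b := by
  unfold gaussSum1
  rw [← (Equiv.neg ℤ).tsum_eq]
  refine tsum_congr fun m => ?_
  congr 3
  rw [← neg_sq]
  congr 1
  simp
  ring

lemma hasSum_gaussSum1 {p : ℝ} (hp : 0 < p) (b : ℝ) :
    HasSum (fun m : ℤ => Real.exp (-(p * ((m : ℝ) + b) ^ 2))) (gaussSum1 p b) :=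
  (summable_exp_neg_int_add_sq hp b).hasSum

lemma one_sub_mul_gaussSum1_zero_le {p : ℝ} (hp : 0 < p) (b : ℝ) :
    (1 - p * b ^ 2) * gaussSum1 p 0 ≤ gaussSum1 p b := by
  have h1 := (hasSum_gaussSum1 hp b).add (hasSum_gaussSum1 hp (-b))
  have h2 := (hasSum_gaussSum1 hp 0).mul_left (2 * (1 - p * b ^ 2))
  rw [gaussSum1_neg] at h1
  have := hasSum_le (fun m => ?_) h2 h1
  · linarith
  · have e1 : -(p * ((m : ℝ) + b) ^ 2) = -(p * ((m : ℝ) + 0) ^ 2) +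
        (-(p * b ^ 2) - 2 * p * m * b) := by
      ring
    have e2 : -(p * ((m : ℝ) + -b) ^ 2) =
      -(p * ((m : ℝ) + 0) ^ 2) + (-(p * b ^ 2) + 2 * p * m * b) := by ring
    rw [e1, e2, Real.exp_add, Real.exp_add _ (-(p * b ^ 2) + _), ← mul_add, mul_comm]
    gcongr
    linarith [Real.add_one_le_exp (-(p * b ^ 2) - 2 * p * m * b),
      Real.add_one_le_exp (-(p * b ^ 2) + 2 * p * m * b)]

lemma one_add_sq_div_two_le_cosh (u : ℝ) : 1 + u ^ 2 / 2 ≤ Real.cosh u := by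
  rw [← Real.cosh_abs, ← sq_abs, show |u| = 2 * (|u| / 2) by ring, Real.cosh_two_mul,
    Real.cosh_sq]
  have := Real.self_le_sinh_iff.mpr (by positivity : 0 ≤ |u| / 2)
  nlinarith [abs_nonneg u]

lemma exp_mul_one_add_sq_le_cosh {p d : ℝ} (hp : 6 ≤ p) (hd0 : 0 ≤ d) (hd : d ≤ 1 / 2) :
    Real.exp (p * d ^ 2) * (1 + d ^ 2) ≤ Real.cosh (p * d) := by
  rcases le_total (p * d) 2 with h | h
  · refine le_trans ?_ (one_add_sq_div_two_le_cosh _)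
    set w := p * d ^ 2 with hw
    have hw0 : 0 ≤ w := by positivity
    have hd3 : d ≤ 1 / 3 := by nlinarith
    have hw1 : w ≤ 2 / 3 := by nlinarith
    have he := (abs_le.mp (Real.abs_exp_sub_one_sub_id_le
      (by rw [abs_of_nonneg hw0]; linarith : |w| ≤ 1))).2
    have hd2 : d ^ 2 ≤ w / 6 := by nlinarith [sq_nonneg d]
    calc Real.exp w * (1 + d ^ 2) ≤ (1 + 5 / 3 * w) * (1 + w / 6) := by
          gcongr
          nlinarith
      _ ≤ 1 + 3 * w := by nlinarith
      _ ≤ 1 + (p * d) ^ 2 / 2 := by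
        rw [show (p * d) ^ 2 = p * w by rw [hw]; ring]
        nlinarith
  · have h1 : Real.exp (p * d) / 2 ≤ Real.cosh (p * d) := by
      rw [Real.cosh_eq]
      have := Real.exp_pos (-(p * d))
      linarith
    refine le_trans ?_ h1
    have h2 : Real.exp (p * d) = Real.exp (p * d ^ 2) * Real.exp (p * d * (1 - d)) := by
      rw [← Real.exp_add]; congr 1; ring
    have h3 : Real.exp 1 ≤ Real.exp (p * d * (1 - d)) := by
      rw [Real.exp_le_exp]; nlinarith
    have h4 := Real.exp_one_gt_d9
    rw [h2, mul_div_assoc]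
    gcongr
    nlinarith

lemma gaussSum1_half_add_ge {p d : ℝ} (hp : 6 ≤ p) (hd : |d| ≤ 1 / 2) :
    (1 + d ^ 2) * gaussSum1 p (1 / 2) ≤ gaussSum1 p (1 / 2 + d) := by
  have hp0 : 0 < p := by linarith
  have h1 := (hasSum_gaussSum1 hp0 (1 / 2 + d)).add (hasSum_gaussSum1 hp0 (1 / 2 - d))
  have h2 := (hasSum_gaussSum1 hp0 (1 / 2)).mul_left (2 * (1 + d ^ 2))
  have e : gaussSum1 p (1 / 2 - d) = gaussSum1 p (1 / 2 + d) := by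
    rw [← gaussSum1_neg, ← gaussSum1_add_int p _ 1]
    congr 1
    push_cast
    ring
  rw [e] at h1
  have := hasSum_le (fun m => ?_) h2 h1
  · linarith
  · have hm : 1 / 2 ≤ |(m : ℝ) + 1 / 2| := by
      rcases le_or_gt 0 m with h | h
      · have : (0 : ℝ) ≤ m := by exact_mod_cast h
        rw [abs_of_nonneg (by linarith)]; linarith
      · have : (m : ℝ) ≤ -1 := by exact_mod_cast Int.le_sub_one_of_lt h
        rw [abs_of_nonpos (by linarith)]; linarith
    have e1 : -(p * ((m : ℝ) + (1 / 2 + d)) ^ 2) = -(p * ((m : ℝ) + 1 / 2) ^ 2) +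
      (-(p * d ^ 2) + -(2 * p * (m + 1 / 2) * d)) := by ring
    have e2 : -(p * ((m : ℝ) + (1 / 2 - d)) ^ 2) = -(p * ((m : ℝ) + 1 / 2) ^ 2) +
      (-(p * d ^ 2) + 2 * p * (m + 1 / 2) * d) := by ring
    have hc : Real.cosh (p * |d|) ≤ Real.cosh (2 * p * (m + 1 / 2) * d) := by
      rw [Real.cosh_le_cosh, abs_of_nonneg (by positivity), abs_mul, abs_mul,
        abs_of_nonneg (by positivity : 0 ≤ 2 * p)]
      gcongr
      nlinarith
    have hc' := exp_mul_one_add_sq_le_cosh hp (abs_nonneg d) hd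
    rw [sq_abs] at hc'
    rw [e1, e2, Real.exp_add, Real.exp_add _ (-(p * d ^ 2) + 2 * p * (m + 1 / 2) * d), ← mul_add,
      mul_comm, Real.exp_add, Real.exp_add (-(p * d ^ 2)), ← mul_add]
    refine mul_le_mul_of_nonneg_left ?_ (Real.exp_pos _).le
    rw [Real.cosh_eq (2 * p * _ * d)] at hc
    rw [Real.exp_neg (p * d ^ 2), ← div_eq_inv_mul, le_div_iff₀ (Real.exp_pos _)]
    linarith

lemma gaussSum1_nonneg (p b : ℝ) : 0 ≤ gaussSum1 p b := tsum_nonneg fun _ => (Real.exp_pos _).le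

lemma gaussSum1_half_le {p : ℝ} (hp : 6 ≤ p) (b : ℝ) : gaussSum1 p (1 / 2) ≤ gaussSum1 p b := by
  have h1 := Int.fract_nonneg b
  have h2 := (Int.fract_lt_one b).le
  have h := gaussSum1_half_add_ge hp (d := Int.fract b - 1 / 2)
    (by rw [abs_le]; constructor <;> linarith)
  rw [show 1 / 2 + (Int.fract b - 1 / 2) = Int.fract b by ring,
    ← gaussSum1_add_int p (Int.fract b) ⌊b⌋, Int.fract_add_floor] at h
  nlinarith [gaussSum1_nonneg p (1 / 2), sq_nonneg (Int.fract b - 1 / 2)]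

lemma exp_neg_div_four_le_gaussSum1_half {p : ℝ} (hp : 0 < p) :
    Real.exp (-(p / 4)) ≤ gaussSum1 p (1 / 2) := by
  refine le_trans (le_of_eq ?_) ((summable_exp_neg_int_add_sq hp (1 / 2)).le_tsum 0
    fun _ _ => (Real.exp_pos _).le)
  congr 1
  push_cast
  ring

lemma gaussSum1_zero_le_two {p : ℝ} (hp : 0 < p) (h : Real.exp (-p) ≤ 1 / 4) :
    gaussSum1 p 0 ≤ 2 := by
  obtain ⟨S, hS, -, -, hle⟩ := hasSum_int_sq_mul_exp hp h
  have h1 := hS.add (hasSum_ite_eq (0 : ℤ) (1 : ℝ))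
  have := hasSum_le (fun m => ?_) (hasSum_gaussSum1 hp 0) h1
  · linarith
  · rcases eq_or_ne m 0 with rfl | hm
    · simp
    · rw [if_neg hm, add_zero, add_zero]
      refine le_mul_of_one_le_left (Real.exp_pos _).le ?_
      have : 1 ≤ m ^ 2 := by
        have := sq_nonneg m
        have : m ^ 2 ≠ 0 := pow_ne_zero _ hm
        omega
      exact_mod_cast this

lemma hasSum_latticeTheta {t y : ℝ} (x : ℝ) (ht : 0 < t) (hy : 0 < y) :
    HasSum (fun n : ℤ => Real.exp (-(Real.pi * t * y * (n : ℝ) ^ 2)) *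
      gaussSum1 (Real.pi * (t / y)) (n * x)) (latticeTheta t x y) := by
  have hs' := (Equiv.prodComm ℤ ℤ).summable_iff.mpr (summable_latticeTheta x ht hy)
  have h := latticeTheta_eq_iterated x ht hy
  unfold gaussSum1
  rw [h]
  refine Summable.hasSum (hs'.prod.congr fun n => ?_)
  rw [← tsum_mul_left]
  refine tsum_congr fun m => ?_
  rw [← Real.exp_add]
  simp only [quadForm, Function.comp_apply, Equiv.prodComm_apply, Prod.swap_prod_mk]
  congr 1
  field_simp
  ring

lemma latticeTheta_half_lt_of_le {t x y : ℝ} (ht : 0 < t) (hy : 0 < y)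
    (hp : 6 ≤ Real.pi * (t / y)) (hb : 3 / 4 * (Real.pi * (t / y)) ≤ Real.pi * t * y)
    (hx0 : 0 ≤ x) (hx : x < 1 / 2) :
    latticeTheta t (1 / 2) y < latticeTheta t x y := by
  have hL := hasSum_latticeTheta x ht hy
  have hR := hasSum_latticeTheta (1 / 2) ht hy
  have ha : 0 < Real.pi * t * y := by positivity
  set p := Real.pi * (t / y)
  set a := Real.pi * t * y
  have hp0 : 0 < p := by linarith
  have hexp : ∀ z : ℝ, 4 ≤ z → Real.exp (-z) ≤ 1 / 4 := by
    intro z hz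
    rw [Real.exp_neg, one_div]
    gcongr
    linarith [Real.add_one_le_exp z]
  have hEa := hexp a (by linarith)
  have hEp := hexp p (by linarith)
  obtain ⟨S, hS, hS0, hSle, -⟩ := hasSum_int_sq_mul_exp ha hEa
  have hg0 := gaussSum1_zero_le_two hp0 hEp
  have hg0' := gaussSum1_nonneg p 0
  have hG := exp_neg_div_four_le_gaussSum1_half hp0
  set G := gaussSum1 p (1 / 2)
  set g := gaussSum1 p 0
  set E := Real.exp (-a) with hE
  have hE0 : 0 < E := Real.exp_pos _
  set d := 1 / 2 - x with hd
  have hd0 : 0 < d := by rw [hd]; linarith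
  set A : Finset ℤ := {1, -1} with hA
  have hc := hasSum_sum_of_ne_finset_zero (L := SummationFilter.unconditional _)
    (f := fun n : ℤ => if n ∈ A then E * G + p * g * E else 0) (s := A) (fun n hn => if_neg hn)
  have hcv : ∑ n ∈ A, (if n ∈ A then E * G + p * g * E else 0) = 2 * (E * G + p * g * E) := by
    rw [Finset.sum_ite_mem, Finset.inter_self, Finset.sum_const,
      show A.card = 2 by rw [hA]; decide]
    simp
    ring
  rw [hcv] at hc
  have hlow := (hc.sub (hS.mul_left (p * g))).mul_left (d ^ 2)
  have hle := hasSum_le (fun n => ?_) hlow (hL.sub hR)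
  · rw [← sub_pos]
    refine lt_of_lt_of_le (mul_pos (by positivity) ?_) hle
    have h4 : 4 * E ^ 3 ≤ 1 / 16 := by
      calc _ ≤ 4 * (1 / 4 : ℝ) ^ 3 := by gcongr
        _ = _ := by norm_num
    have hS2 : S ≤ 2 * E + 10 * E * E ^ 3 := by
      refine hSle.trans ?_
      rw [div_le_iff₀ (by linarith)]
      nlinarith [mul_pos hE0 (pow_pos hE0 3)]
    have hE3 : E ^ 3 ≤ Real.exp (-(p / 4)) * Real.exp (-(2 * p)) := by
      rw [hE, ← Real.exp_nat_mul, ← Real.exp_add, Real.exp_le_exp]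
      push_cast
      linarith
    have h2p : 10 * p * Real.exp (-(2 * p)) < 1 := by
      rw [Real.exp_neg, ← div_eq_mul_inv, div_lt_one (Real.exp_pos _)]
      have := Real.quadratic_le_exp_of_nonneg (by positivity : 0 ≤ 2 * p)
      nlinarith
    have hfin : 10 * p * E ^ 3 < G := by
      calc 10 * p * E ^ 3 ≤ 10 * p * (Real.exp (-(p / 4)) * Real.exp (-(2 * p))) := by gcongr
        _ = Real.exp (-(p / 4)) * (10 * p * Real.exp (-(2 * p))) := by ring
        _ < Real.exp (-(p / 4)) * 1 := by gcongr
        _ ≤ G := by linarith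
    have hpg : p * g * S ≤ p * g * (2 * E + 10 * E * E ^ 3) := by gcongr
    have hpg2 : p * g * (10 * E * E ^ 3) ≤ p * 2 * (10 * E * E ^ 3) := by gcongr
    nlinarith [mul_lt_mul_of_pos_left hfin hE0]
  · have hn0 : 0 < Real.exp (-(a * (n : ℝ) ^ 2)) := Real.exp_pos _
    rw [← mul_sub]
    by_cases hn : n ∈ A
    · have hv : n = 1 ∨ n = -1 := by simpa [hA] using hn
      have hsq : (n : ℝ) ^ 2 = 1 := by rcases hv with rfl | rfl <;> norm_num
      have e1 : ∀ z, gaussSum1 p (n * z) = gaussSum1 p z := by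
        intro z
        rcases hv with rfl | rfl
        · simp
        · simp [gaussSum1_neg]
      have hge := gaussSum1_half_add_ge hp (d := -d)
        (by rw [abs_neg, abs_of_pos hd0, hd]; linarith)
      rw [neg_sq, show 1 / 2 + -d = x by rw [hd]; ring] at hge
      rw [if_pos hn, e1, e1, hsq, mul_one]
      calc _ = E * (d ^ 2 * G) := by ring
        _ ≤ _ := by gcongr; linarith
    · rw [if_neg hn]
      have hrhs : d ^ 2 * (0 - p * g * ((n : ℝ) ^ 2 * Real.exp (-(a * (n : ℝ) ^ 2)))) =
        Real.exp (-(a * (n : ℝ) ^ 2)) * (-(p * ((n : ℝ) * d) ^ 2 * g)) := by ring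
      rw [hrhs]
      gcongr
      rcases Int.even_or_odd' n with ⟨j, hj | hj⟩
      · have e1 : gaussSum1 p (n * (1 / 2)) = g := by
          rw [show (n : ℝ) * (1 / 2) = 0 + (j : ℝ) by rw [hj]; push_cast; ring, gaussSum1_add_int]
        have e2 : gaussSum1 p (n * x) = gaussSum1 p (n * d) := by
          rw [show (n : ℝ) * x = -(n * d) + (j : ℝ) by rw [hj, hd]; push_cast; ring,
            gaussSum1_add_int, gaussSum1_neg]
        rw [e1, e2]
        linarith [one_sub_mul_gaussSum1_zero_le hp0 (n * d)]
      · have e1 : gaussSum1 p (n * (1 / 2)) = G := by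
          rw [show (n : ℝ) * (1 / 2) = 1 / 2 + (j : ℝ) by rw [hj]; push_cast; ring,
            gaussSum1_add_int]
        rw [e1]
        have : 0 ≤ p * ((n : ℝ) * d) ^ 2 * g := by positivity
        linarith [gaussSum1_half_le hp (n * x)]

/-- Among forms with fixed `y ≥ √3/2`, the theta function is least at `x = 1/2`. -/
lemma latticeTheta_half_lt {t x y : ℝ} (ht : 1 ≤ t) (hy : 0 < y) (hy2 : 3 / 4 ≤ y ^ 2)
    (hx0 : 0 ≤ x) (hx : x < 1 / 2) :
    latticeTheta t (1 / 2) y < latticeTheta t x y := by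
  have ht0 : 0 < t := by linarith
  have hpi := Real.pi_gt_d2
  rcases le_total 6 (Real.pi * (t / y)) with h | h
  · refine latticeTheta_half_lt_of_le ht0 hy h ?_ hx0 hx
    rw [show Real.pi * t * y = y ^ 2 * (Real.pi * (t / y)) by field_simp]
    gcongr
  · have hexp : ∀ z : ℝ, 3 / 2 ≤ z → Real.exp (-z) ≤ 1 / 4 := by
      intro z hz
      rw [Real.exp_neg, one_div]
      gcongr
      have h1 := Real.sum_le_exp_of_nonneg (by norm_num : (0 : ℝ) ≤ 3 / 2) 5
      have h2 : Real.exp (3 / 2) ≤ Real.exp z := Real.exp_le_exp.mpr hz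
      norm_num [Finset.sum_range_succ, Nat.factorial] at h1
      linarith
    refine latticeTheta_half_lt_of_exp_le ht0 hy (hexp _ ?_) (hexp _ ?_) ?_
    · have : Real.pi * (y / t) * (Real.pi * (t / y)) = Real.pi ^ 2 := by field_simp
      have h0 : 0 < Real.pi * (y / t) := by positivity
      nlinarith
    · have : 3 / 4 ≤ y := by nlinarith
      have : 3 / 4 ≤ t * y := by nlinarith
      nlinarith
    · refine (Real.cos_pos_of_mem_Ioo ⟨?_, ?_⟩).ne' <;> nlinarith [Real.pi_pos]

lemma cubic_le_exp (x : ℝ) : 1 + x + x ^ 2 / 2 + x ^ 3 / 6 ≤ Real.exp x := by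
  rcases le_total 0 x with hx | hx
  · have := Real.sum_le_exp_of_nonneg hx 4
    norm_num [Finset.sum_range_succ, Nat.factorial] at this
    linarith
  · set f : ℝ → ℝ := fun x => (1 + x + x ^ 2 / 2 + x ^ 3 / 6) * Real.exp (-x) with hf
    have hd : ∀ z, HasDerivAt f (-(z ^ 3 / 6) * Real.exp (-z)) z := by
      intro z
      have h1 : HasDerivAt (fun x : ℝ => 1 + x + x ^ 2 / 2 + x ^ 3 / 6)
          (1 + z + z ^ 2 / 2) z := by
        have := (((hasDerivAt_id z).const_add 1).add (((hasDerivAt_id z).pow 2).div_const 2)).add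
          (((hasDerivAt_id z).pow 3).div_const 6)
        refine this.congr_deriv ?_
        simp
        ring
      have h2 : HasDerivAt (fun x : ℝ => Real.exp (-x)) (-Real.exp (-z)) z := by
        simpa using (hasDerivAt_neg z).exp
      refine (h1.mul h2).congr_deriv ?_
      ring
    have hmono : MonotoneOn f (Set.Iic 0) := by
      refine monotoneOn_of_deriv_nonneg (convex_Iic 0)
        (fun z _ => (hd z).continuousAt.continuousWithinAt)
        (fun z _ => (hd z).differentiableAt.differentiableWithinAt) fun z hz => ?_
      rw [interior_Iic, Set.mem_Iio] at hz
      rw [(hd z).deriv]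
      have : 0 < (-z) ^ 3 := pow_pos (by linarith) 3
      refine mul_nonneg ?_ (Real.exp_pos _).le
      nlinarith
    have h := hmono (Set.mem_Iic.mpr hx) (Set.mem_Iic.mpr le_rfl) hx
    simp only [hf] at h
    rw [Real.exp_neg, ← div_eq_mul_inv, div_le_iff₀ (Real.exp_pos _)] at h
    simpa using h

lemma three_lt_exp {z : ℝ} (hz : 9 / 8 ≤ z) : 3 < Real.exp z := by
  have h1 := Real.sum_le_exp_of_nonneg (by norm_num : (0 : ℝ) ≤ 9 / 8) 6
  have h2 : Real.exp (9 / 8) ≤ Real.exp z := Real.exp_le_exp.mpr hz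
  norm_num [Finset.sum_range_succ, Nat.factorial] at h1
  linarith

lemma exp_le_one_add_add_sq {w : ℝ} (h0 : 0 ≤ w) (h1 : w ≤ 1) :
    Real.exp w ≤ 1 + w + w ^ 2 := by
  have := (abs_le.mp (Real.abs_exp_sub_one_sub_id_le
    (by rw [abs_of_nonneg h0]; linarith : |w| ≤ 1))).2
  linarith

/-- The three numbers `xᵢ` are the roots of `X³ - (3/4) z² X - x₁x₂x₃`. -/
lemma sum_exp_ge_cubic {x₁ x₂ x₃ z : ℝ} (hsum : x₁ + x₂ + x₃ = 0)
    (hsq : x₁ ^ 2 + x₂ ^ 2 + x₃ ^ 2 = 3 / 2 * z ^ 2) :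
    3 + 3 / 4 * z ^ 2 + x₁ * x₂ * x₃ / 2 ≤ Real.exp x₁ + Real.exp x₂ + Real.exp x₃ := by
  have h1 := cubic_le_exp x₁
  have h2 := cubic_le_exp x₂
  have h3 := cubic_le_exp x₃
  have h : x₁ ^ 3 + x₂ ^ 3 + x₃ ^ 3 = 3 * (x₁ * x₂ * x₃) := by
    obtain rfl : x₃ = -x₁ - x₂ := by linarith
    ring
  linarith

lemma sq_prod_le {x₁ x₂ x₃ z : ℝ} (hsum : x₁ + x₂ + x₃ = 0)
    (hsq : x₁ ^ 2 + x₂ ^ 2 + x₃ ^ 2 = 3 / 2 * z ^ 2) :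
    (x₁ * x₂ * x₃) ^ 2 ≤ (z ^ 3 / 4) ^ 2 := by
  obtain rfl : x₃ = -x₁ - x₂ := by linarith
  have hz : z ^ 2 = 4 / 3 * (x₁ ^ 2 + x₁ * x₂ + x₂ ^ 2) := by linarith
  have h6 : (z ^ 3 / 4) ^ 2 = (z ^ 2) ^ 3 / 16 := by ring
  rw [h6, hz]
  nlinarith [sq_nonneg ((x₁ - x₂) * (2 * x₁ + x₂) * (x₁ + 2 * x₂))]

lemma three_mul_exp_lt_of_eq {x₁ x₂ x₃ z ρ : ℝ} (h1 : x₁ = z) (hsum : x₁ + x₂ + x₃ = 0)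
    (hsq : x₁ ^ 2 + x₂ ^ 2 + x₃ ^ 2 = 3 / 2 * z ^ 2)
    (hz : 0 < z) (hρ0 : 0 ≤ ρ) (hρ : ρ ≤ 1 / 5) (hρz : ρ ≤ z / 7) :
    3 * Real.exp (z * ρ) < Real.exp x₁ + Real.exp x₂ + Real.exp x₃ := by
  rcases le_total z (5 / 3) with h | h
  · have hw0 : 0 ≤ z * ρ := by positivity
    have hw1 : z * ρ ≤ 1 / 3 := by nlinarith
    have he := exp_le_one_add_add_sq hw0 (by linarith)
    have hw2 : z * ρ ≤ z ^ 2 / 7 := by nlinarith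
    have hc := sum_exp_ge_cubic hsum hsq
    have hp : 0 ≤ x₁ * x₂ * x₃ := by
      have : x₂ * x₃ = z ^ 2 / 4 := by
        obtain rfl : x₃ = -x₁ - x₂ := by linarith
        subst h1
        linarith
      rw [mul_assoc, this, h1]
      positivity
    nlinarith
  · have h2 : 3 * Real.exp (z * ρ) < Real.exp (z * (1 - ρ)) * Real.exp (z * ρ) :=
      mul_lt_mul_of_pos_right (three_lt_exp (by nlinarith)) (Real.exp_pos _)
    rw [← Real.exp_add, show z * (1 - ρ) + z * ρ = z by ring] at h2
    rw [h1]
    linarith [Real.exp_pos x₂, Real.exp_pos x₃]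

lemma half_le_of_sum_eq_zero {x₁ x₂ x₃ z : ℝ} (hsum : x₁ + x₂ + x₃ = 0)
    (hsq : x₁ ^ 2 + x₂ ^ 2 + x₃ ^ 2 = 3 / 2 * z ^ 2) :
    z / 2 ≤ x₁ ∨ z / 2 ≤ x₂ ∨ z / 2 ≤ x₃ := by
  by_contra! h
  obtain ⟨h1, h2, h3⟩ := h
  obtain rfl : x₃ = -x₁ - x₂ := by linarith
  nlinarith [mul_pos (sub_pos.2 h1) (sub_pos.2 h2), mul_pos (sub_pos.2 h1) (sub_pos.2 h3),
    mul_pos (sub_pos.2 h2) (sub_pos.2 h3)]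

lemma three_mul_exp_le {x₁ x₂ x₃ z ρ : ℝ} (hsum : x₁ + x₂ + x₃ = 0)
    (hsq : x₁ ^ 2 + x₂ ^ 2 + x₃ ^ 2 = 3 / 2 * z ^ 2)
    (hz : 0 ≤ z) (hρ0 : 0 ≤ ρ) (hρ : ρ ≤ 1 / 5) (hρz : ρ ≤ z / 21) :
    3 * Real.exp (z * ρ) ≤ Real.exp x₁ + Real.exp x₂ + Real.exp x₃ := by
  rcases le_total z (15 / 4) with h | h
  · have hw0 : 0 ≤ z * ρ := by positivity
    have hw1 : z * ρ ≤ 3 / 4 := by nlinarith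
    have he := exp_le_one_add_add_sq hw0 (by linarith)
    have hw2 : z * ρ ≤ z ^ 2 / 21 := by nlinarith
    have hc := sum_exp_ge_cubic hsum hsq
    have hp := (abs_le.mp (abs_le_of_sq_le_sq (sq_prod_le hsum hsq) (by positivity))).1
    have hp' : z ^ 3 ≤ 15 / 4 * z ^ 2 := by nlinarith [sq_nonneg z]
    nlinarith
  · have h2 : 3 * Real.exp (z * ρ) < Real.exp (z * (1 / 2 - ρ)) * Real.exp (z * ρ) :=
      mul_lt_mul_of_pos_right (three_lt_exp (by nlinarith)) (Real.exp_pos _)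
    rw [← Real.exp_add, show z * (1 / 2 - ρ) + z * ρ = z / 2 by ring] at h2
    have e1 := Real.exp_pos x₁
    have e2 := Real.exp_pos x₂
    have e3 := Real.exp_pos x₃
    rcases half_le_of_sum_eq_zero hsum hsq with hx | hx | hx <;>
      linarith [Real.exp_le_exp.mpr hx]

/-- The Gaussian term at `p` of the lattice with parameters `x = 1 / 2`, `y = (√3 / 2) r`. -/
noncomputable def rhombicTerm (T r : ℝ) (p : ℤ × ℤ) : ℝ :=
  Real.exp (-(T * (((p.1 : ℝ) + p.2 / 2) ^ 2 / r + 3 / 4 * (p.2 : ℝ) ^ 2 * r)))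

lemma exp_quadForm_half (t : ℝ) {r : ℝ} (hr : 0 < r) (p : ℤ × ℤ) :
    Real.exp (-(Real.pi * t * quadForm (1 / 2) (Real.sqrt 3 / 2 * r) p)) =
      rhombicTerm (2 * Real.pi * t / Real.sqrt 3) r p := by
  have h3 : (0 : ℝ) < Real.sqrt 3 := by positivity
  have h3' : Real.sqrt 3 ^ 2 = 3 := Real.sq_sqrt (by norm_num)
  rw [rhombicTerm, quadForm]
  congr 2
  field_simp
  ring_nf
  rw [h3']
  ring

lemma latticeTheta_half_eq (t : ℝ) {r : ℝ} (hr : 0 < r) :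
    latticeTheta t (1 / 2) (Real.sqrt 3 / 2 * r) =
      ∑' p, rhombicTerm (2 * Real.pi * t / Real.sqrt 3) r p := by
  rw [latticeTheta]
  exact tsum_congr (exp_quadForm_half t hr)

lemma summable_rhombicTerm {T r : ℝ} (hT : 0 < T) (hr : 0 < r) : Summable (rhombicTerm T r) := by
  have h3 : (0 : ℝ) < Real.sqrt 3 := by positivity
  have h := summable_latticeTheta (1 / 2) (t := T * Real.sqrt 3 / (2 * Real.pi))
    (y := Real.sqrt 3 / 2 * r) (by positivity) (by positivity)
  refine h.congr fun p => ?_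
  rw [exp_quadForm_half _ hr]
  congr 1
  field_simp

/-- The rotation of order three of the triangular lattice. -/
def hexRotation : ℤ × ℤ ≃ ℤ × ℤ where
  toFun p := (-p.1 - p.2, p.1)
  invFun p := (p.2, -p.1 - p.2)
  left_inv p := by ext <;> simp
  right_inv p := by ext <;> simp; ring

lemma three_mul_tsum_rhombicTerm {T r : ℝ} (hT : 0 < T) (hr : 0 < r) :
    Summable (fun p => rhombicTerm T r p + rhombicTerm T r (hexRotation p) +
      rhombicTerm T r (hexRotation (hexRotation p))) ∧
    ∑' p, (rhombicTerm T r p + rhombicTerm T r (hexRotation p) +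
      rhombicTerm T r (hexRotation (hexRotation p))) = 3 * ∑' p, rhombicTerm T r p := by
  have h0 := summable_rhombicTerm hT hr
  have h1 : Summable (fun p => rhombicTerm T r (hexRotation p)) :=
    hexRotation.summable_iff.mpr h0
  have h2 : Summable (fun p => rhombicTerm T r (hexRotation (hexRotation p))) :=
    hexRotation.summable_iff.mpr h1
  refine ⟨(h0.add h1).add h2, ?_⟩
  rw [(h0.add h1).tsum_add h2, h0.tsum_add h1,
    hexRotation.tsum_eq (fun p => rhombicTerm T r (hexRotation p)), hexRotation.tsum_eq]
  ring

lemma hex_norm_cases (m n : ℤ) :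
    (m = 0 ∧ n = 0) ∨
    (m ^ 2 + m * n + n ^ 2 = 1 ∧
      ((m, n) = (1, 0) ∨ (m, n) = (-1, 0) ∨ (m, n) = (0, 1) ∨ (m, n) = (0, -1) ∨
        (m, n) = (1, -1) ∨ (m, n) = (-1, 1))) ∨
    3 ≤ m ^ 2 + m * n + n ^ 2 := by
  by_cases h : 3 ≤ m ^ 2 + m * n + n ^ 2
  · exact Or.inr (Or.inr h)
  · have h' : m ^ 2 + m * n + n ^ 2 ≤ 2 := by omega
    have hm1 : m ≤ 1 := by nlinarith [sq_nonneg (m + 2 * n)]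
    have hm2 : -1 ≤ m := by nlinarith [sq_nonneg (m + 2 * n)]
    have hn1 : n ≤ 1 := by nlinarith [sq_nonneg (2 * m + n)]
    have hn2 : -1 ≤ n := by nlinarith [sq_nonneg (2 * m + n)]
    interval_cases m <;> interval_cases n <;> simp_all

lemma orbit_exponent_bounds {r : ℝ} (hr : 1 ≤ r) (hr2 : r ≤ 3 / 2) :
    0 ≤ (r - 1) / (r + 1) ∧ (r - 1) / (r + 1) ≤ 1 / 5 ∧
      2 * ((r - 1) / (r + 1)) ≤ (r - 1 / r) / 2 := by
  have h0 : 0 ≤ r - 1 := by linarith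
  refine ⟨by positivity, ?_, ?_⟩
  · rw [div_le_iff₀ (by linarith)]
    linarith
  · have : (r - 1 / r) / 2 - 2 * ((r - 1) / (r + 1)) = (r - 1) ^ 3 / (2 * r * (r + 1)) := by
      field_simp
      ring
    have h2 : 0 ≤ (r - 1) ^ 3 / (2 * r * (r + 1)) := by positivity
    linarith

lemma orbit_sum_eq {T r : ℝ} (hr : 0 < r) (m n : ℤ) :
    rhombicTerm T r (m, n) + rhombicTerm T r (hexRotation (m, n)) +
      rhombicTerm T r (hexRotation (hexRotation (m, n))) =
    Real.exp (-(T * ((m : ℝ) ^ 2 + m * n + n ^ 2) * ((r + 1 / r) / 2))) *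
      (Real.exp (T * ((r - 1 / r) / 2) * ((m : ℝ) ^ 2 + m * n - n ^ 2 / 2)) +
       Real.exp (T * ((r - 1 / r) / 2) * ((n : ℝ) ^ 2 + m * n - m ^ 2 / 2)) +
       Real.exp (T * ((r - 1 / r) / 2) * (-2 * m * n - (m : ℝ) ^ 2 / 2 - n ^ 2 / 2))) := by
  simp only [rhombicTerm, hexRotation, Equiv.coe_fn_mk, mul_add, ← Real.exp_add]
  push_cast
  congr 1
  · congr 1
    · congr 1
      field_simp
      ring
    · congr 1
      field_simp
      ring
  · congr 1
    field_simp
    ring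

lemma three_mul_rhombicTerm_one {T r : ℝ} (hr : 0 < r) (m n : ℤ) :
    3 * rhombicTerm T 1 (m, n) =
    Real.exp (-(T * ((m : ℝ) ^ 2 + m * n + n ^ 2) * ((r + 1 / r) / 2))) *
      (3 * Real.exp (T * ((r - 1 / r) / 2) * ((m : ℝ) ^ 2 + m * n + n ^ 2) *
        ((r - 1) / (r + 1)))) := by
  rw [mul_left_comm, ← Real.exp_add, rhombicTerm]
  congr 2
  field_simp
  ring

lemma three_mul_rhombicTerm_lt {T r : ℝ} (hT : 7 / 2 ≤ T) (hr : 1 < r) (hr2 : r ≤ 3 / 2)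
    {m n : ℤ} (hk : m ^ 2 + m * n + n ^ 2 = 1)
    (h : (m, n) = (1, 0) ∨ (m, n) = (-1, 0) ∨ (m, n) = (0, 1) ∨ (m, n) = (0, -1) ∨
        (m, n) = (1, -1) ∨ (m, n) = (-1, 1)) :
    3 * rhombicTerm T 1 (m, n) <
      rhombicTerm T r (m, n) + rhombicTerm T r (hexRotation (m, n)) +
      rhombicTerm T r (hexRotation (hexRotation (m, n))) := by
  have hr0 : 0 < r := by linarith
  obtain ⟨hρ0, hρ, hS⟩ := orbit_exponent_bounds hr.le hr2
  rw [orbit_sum_eq hr0, three_mul_rhombicTerm_one hr0]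
  refine mul_lt_mul_of_pos_left ?_ (Real.exp_pos _)
  have hkR : (m : ℝ) ^ 2 + m * n + n ^ 2 = 1 := by exact_mod_cast hk
  have hρpos : 0 < (r - 1) / (r + 1) := div_pos (by linarith) (by linarith)
  rw [hkR, mul_one]
  set ρ := (r - 1) / (r + 1)
  set S := (r - 1 / r) / 2
  have hTS : 7 * ρ ≤ T * S := by nlinarith
  have key : ∀ a b : ℝ, a + b = -1 → a ^ 2 + b ^ 2 = 1 / 2 →
      3 * Real.exp (T * S * ρ) <
        Real.exp (T * S * 1) + Real.exp (T * S * a) + Real.exp (T * S * b) := by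
    intro a b hab hab2
    refine three_mul_exp_lt_of_eq (mul_one _) ?_ ?_ (by nlinarith) hρ0 hρ (by linarith)
    · linear_combination (T * S) * hab
    · linear_combination (T * S) ^ 2 * hab2
  simp only [Prod.mk.injEq] at h
  rcases h with ⟨rfl, rfl⟩ | ⟨rfl, rfl⟩ | ⟨rfl, rfl⟩ | ⟨rfl, rfl⟩ | ⟨rfl, rfl⟩ | ⟨rfl, rfl⟩ <;>
    refine (key (-1 / 2) (-1 / 2) (by norm_num) (by norm_num)).trans_eq ?_ <;>
    norm_num <;> ring_nf

lemma three_mul_rhombicTerm_le {T r : ℝ} (hT : 7 / 2 ≤ T) (hr : 1 < r) (hr2 : r ≤ 3 / 2)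
    (p : ℤ × ℤ) :
    3 * rhombicTerm T 1 p ≤ rhombicTerm T r p + rhombicTerm T r (hexRotation p) +
      rhombicTerm T r (hexRotation (hexRotation p)) := by
  obtain ⟨m, n⟩ := p
  rcases hex_norm_cases m n with ⟨rfl, rfl⟩ | ⟨hk, h⟩ | hk
  · norm_num [rhombicTerm, hexRotation]
  · exact (three_mul_rhombicTerm_lt hT hr hr2 hk h).le
  · have hr0 : 0 < r := by linarith
    obtain ⟨hρ0, hρ, hS⟩ := orbit_exponent_bounds hr.le hr2
    rw [orbit_sum_eq hr0, three_mul_rhombicTerm_one hr0]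
    refine mul_le_mul_of_nonneg_left ?_ (Real.exp_pos _).le
    have hkR : 3 ≤ (m : ℝ) ^ 2 + m * n + n ^ 2 := by exact_mod_cast hk
    set ρ := (r - 1) / (r + 1)
    set S := (r - 1 / r) / 2
    have hTS : 7 * ρ ≤ T * S := by nlinarith
    refine three_mul_exp_le ?_ ?_ (mul_nonneg (by linarith) (by linarith)) hρ0 hρ (by nlinarith)
    · ring
    · ring

lemma tsum_rhombicTerm_lt_of_le {T r : ℝ} (hT : 7 / 2 ≤ T) (hr : 1 < r) (hr2 : r ≤ 3 / 2) :
    ∑' p, rhombicTerm T 1 p < ∑' p, rhombicTerm T r p := by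
  have hT0 : 0 < T := by linarith
  obtain ⟨hs, he⟩ := three_mul_tsum_rhombicTerm hT0 (by linarith : 0 < r)
  have h := Summable.tsum_lt_tsum (i := ((1 : ℤ), (0 : ℤ)))
    (three_mul_rhombicTerm_le hT hr hr2)
    (three_mul_rhombicTerm_lt hT hr hr2 (by norm_num) (Or.inl rfl))
    ((summable_rhombicTerm hT0 one_pos).mul_left 3) hs
  rw [he, tsum_mul_left] at h
  linarith

lemma hasSum_pow_natAbs {q : ℝ} (h0 : 0 ≤ q) (h1 : q < 1) :
    HasSum (fun m : ℤ => q ^ m.natAbs) ((1 + q) / (1 - q)) := by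
  have hg := hasSum_geometric_of_lt_one h0 h1
  have h := HasSum.of_nat_of_neg_add_one (f := fun m : ℤ => q ^ m.natAbs)
    (m := (1 - q)⁻¹) (m' := q * (1 - q)⁻¹) (by simpa using hg)
    (by
      refine (hg.mul_left q).congr_fun fun n => ?_
      have : (-((n : ℤ) + 1)).natAbs = n + 1 := by omega
      simp only [this]
      ring)
  convert h using 1
  field_simp

lemma hasSum_pow_natAbs_add {q : ℝ} (h0 : 0 ≤ q) (h1 : q < 1) :
    HasSum (fun p : ℤ × ℤ => q ^ (p.1.natAbs + p.2.natAbs)) (((1 + q) / (1 - q)) ^ 2) := by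
  have h := hasSum_pow_natAbs h0 h1
  have := h.mul h (h.summable.mul_of_nonneg h.summable (fun _ => by positivity)
    fun _ => by positivity)
  simpa only [← pow_add, ← sq] using this

lemma two_mul_natAbs_add_le {m n : ℤ} (hk : 3 ≤ m ^ 2 + m * n + n ^ 2) :
    2 * ((m.natAbs + n.natAbs : ℕ) : ℤ) + 3 ≤ 3 * (m ^ 2 + m * n + n ^ 2) := by
  push_cast
  have h4 : (|m| + |n|) ^ 2 ≤ 4 * (m ^ 2 + m * n + n ^ 2) := by
    have h5 : |m| * |n| ≤ m ^ 2 + 2 * (m * n) + n ^ 2 + |m| * |n| := by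
      nlinarith [sq_nonneg (m + n)]
    have h6 : -(m * n) ≤ |m| * |n| := by rw [← abs_mul]; exact neg_le_abs _
    nlinarith [sq_abs m, sq_abs n, sq_nonneg (|m| - |n|)]
  rcases le_or_gt (|m| + |n|) 3 with h | h
  · linarith
  · nlinarith

/-- The six shortest nonzero vectors of the triangular lattice. -/
def hexShell : Finset (ℤ × ℤ) := {(1, 0), (-1, 0), (0, 1), (0, -1), (1, -1), (-1, 1)}

lemma rhombicTerm_one_le {T : ℝ} (hT : 0 < T) (p : ℤ × ℤ) :
    rhombicTerm T 1 p ≤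
      Real.exp (-T) * Real.exp (-(2 * T / 3)) ^ (p.1.natAbs + p.2.natAbs) +
      ((if p = 0 then 1 - Real.exp (-T) else 0) + if p ∈ hexShell then Real.exp (-T) else 0) := by
  obtain ⟨m, n⟩ := p
  have hk1 : rhombicTerm T 1 (m, n) = Real.exp (-(T * ((m ^ 2 + m * n + n ^ 2 : ℤ) : ℝ))) := by
    rw [rhombicTerm]
    push_cast
    congr 1
    ring
  have hε : Real.exp (-T) ≤ 1 := Real.exp_le_one_iff.mpr (by linarith)
  have hpos : 0 ≤ Real.exp (-T) * Real.exp (-(2 * T / 3)) ^ (m.natAbs + n.natAbs) := by positivity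
  rcases hex_norm_cases m n with ⟨rfl, rfl⟩ | ⟨hk, h⟩ | hk
  · simp [rhombicTerm, hexShell]
  · have hmem : (m, n) ∈ hexShell := by simpa [hexShell] using h
    have h0 : (m, n) ≠ 0 := by
      rintro h0
      rw [h0] at hmem
      exact absurd hmem (by decide)
    rw [hk1, hk, if_neg h0, if_pos hmem]
    simpa using hpos
  · have hle : rhombicTerm T 1 (m, n) ≤
        Real.exp (-T) * Real.exp (-(2 * T / 3)) ^ (m.natAbs + n.natAbs) := by
      rw [hk1, ← Real.exp_nat_mul, ← Real.exp_add, Real.exp_le_exp]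
      have h : 2 * ((m.natAbs + n.natAbs : ℕ) : ℝ) + 3 ≤ 3 * ((m ^ 2 + m * n + n ^ 2 : ℤ) : ℝ) := by
        have h' := (Int.cast_le (R := ℝ)).mpr (two_mul_natAbs_add_le hk)
        push_cast at h' ⊢
        simpa only [Nat.cast_natAbs, Int.cast_abs] using h'
      nlinarith
    refine hle.trans (le_add_of_nonneg_right ?_)
    have : 0 ≤ 1 - Real.exp (-T) := by linarith
    positivity

lemma tsum_rhombicTerm_one_le {T : ℝ} (hT : 0 < T) :
    ∑' p, rhombicTerm T 1 p ≤
      Real.exp (-T) * ((1 + Real.exp (-(2 * T / 3))) / (1 - Real.exp (-(2 * T / 3)))) ^ 2 +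
      (1 - Real.exp (-T) + 6 * Real.exp (-T)) := by
  have h1 := (hasSum_pow_natAbs_add (Real.exp_pos (-(2 * T / 3))).le
    (Real.exp_lt_one_iff.mpr (by linarith))).mul_left (Real.exp (-T))
  have h2 : HasSum (fun p : ℤ × ℤ => if p = 0 then 1 - Real.exp (-T) else 0)
      (1 - Real.exp (-T)) := hasSum_ite_eq 0 _
  have h3 : HasSum (fun p : ℤ × ℤ => if p ∈ hexShell then Real.exp (-T) else 0)
      (6 * Real.exp (-T)) := by
    have := hasSum_sum_of_ne_finset_zero (s := hexShell)
      (L := SummationFilter.unconditional _)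
      (f := fun p : ℤ × ℤ => if p ∈ hexShell then Real.exp (-T) else 0)
      (fun p hp => if_neg hp)
    rw [Finset.sum_ite_mem, Finset.inter_self, Finset.sum_const,
      show hexShell.card = 6 by decide] at this
    simpa using this
  exact hasSum_le (rhombicTerm_one_le hT) (summable_rhombicTerm hT one_pos).hasSum
    (h1.add (h2.add h3))

lemma le_tsum_rhombicTerm {T r : ℝ} (hT : 0 < T) (hr : 3 / 2 ≤ r) :
    1 + 2 * Real.exp (-(2 * T / 3)) ≤ ∑' p, rhombicTerm T r p := by
  have hr0 : 0 < r := by linarith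
  have h := (summable_rhombicTerm hT hr0).sum_le_tsum {((0 : ℤ), (0 : ℤ)), (1, 0), (-1, 0)}
    (fun p _ => by rw [rhombicTerm]; positivity)
  rw [Finset.sum_insert (by simp), Finset.sum_insert (by simp), Finset.sum_singleton] at h
  have h1 : Real.exp (-(2 * T / 3)) ≤ Real.exp (-(T / r)) := by
    rw [Real.exp_le_exp, neg_le_neg_iff, div_le_div_iff₀ hr0 (by norm_num)]
    nlinarith
  have e0 : rhombicTerm T r (0, 0) = 1 := by simp [rhombicTerm]
  have e1 : rhombicTerm T r (1, 0) = Real.exp (-(T / r)) := by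
    simp [rhombicTerm, div_eq_mul_inv]
  have e2 : rhombicTerm T r (-1, 0) = Real.exp (-(T / r)) := by
    simp [rhombicTerm, div_eq_mul_inv]
  rw [e0, e1, e2] at h
  linarith

lemma tsum_rhombicTerm_lt_of_ge {T r : ℝ} (hT : 18 / 5 ≤ T) (hr : 3 / 2 ≤ r) :
    ∑' p, rhombicTerm T 1 p < ∑' p, rhombicTerm T r p := by
  have hT0 : 0 < T := by linarith
  refine (tsum_rhombicTerm_one_le hT0).trans_lt (lt_of_lt_of_le ?_ (le_tsum_rhombicTerm hT0 hr))
  have hη : Real.exp (-(2 * T / 3)) = Real.exp (-T) * Real.exp (T / 3) := by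
    rw [← Real.exp_add]
    congr 1
    ring
  have h12 : 331 / 100 ≤ Real.exp (T / 3) := by
    have h1 := Real.sum_le_exp_of_nonneg (by norm_num : (0 : ℝ) ≤ 6 / 5) 7
    have h2 : Real.exp (6 / 5) ≤ Real.exp (T / 3) := Real.exp_le_exp.mpr (by linarith)
    norm_num [Finset.sum_range_succ, Nat.factorial] at h1
    linarith
  have hη10 : Real.exp (-(2 * T / 3)) ≤ 1 / 10 := by
    have : Real.exp (-(2 * T / 3)) * (Real.exp (T / 3) * Real.exp (T / 3)) = 1 := by
      rw [← Real.exp_add, ← Real.exp_add, Real.exp_eq_one_iff]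
      ring
    nlinarith [Real.exp_pos (-(2 * T / 3))]
  have hη0 := Real.exp_pos (-(2 * T / 3))
  have hε0 := Real.exp_pos (-T)
  set η := Real.exp (-(2 * T / 3))
  have hfrac : (1 + η) / (1 - η) ≤ 11 / 9 := by
    rw [div_le_div_iff₀ (by linarith) (by norm_num)]
    linarith
  have hfrac0 : 0 ≤ (1 + η) / (1 - η) := div_nonneg (by linarith) (by linarith)
  have hsq : ((1 + η) / (1 - η)) ^ 2 ≤ 3 / 2 := by nlinarith
  nlinarith

lemma latticeTheta_half_lt_half {t y : ℝ} (ht : 1 ≤ t) (hy : Real.sqrt 3 / 2 < y) :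
    latticeTheta t (1 / 2) (Real.sqrt 3 / 2) < latticeTheta t (1 / 2) y := by
  have h3 : (0 : ℝ) < Real.sqrt 3 := by positivity
  have h3' : Real.sqrt 3 ≤ 1733 / 1000 := by
    rw [Real.sqrt_le_left (by norm_num)]
    norm_num
  have hT : 18 / 5 ≤ 2 * Real.pi * t / Real.sqrt 3 := by
    rw [le_div_iff₀ h3]
    nlinarith [Real.pi_gt_d2]
  have hr : 1 < y / (Real.sqrt 3 / 2) := by rwa [one_lt_div (by positivity)]
  have e1 := latticeTheta_half_eq t one_pos
  have e2 := latticeTheta_half_eq t (one_pos.trans hr)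
  rw [mul_one] at e1
  rw [mul_div_cancel₀ _ (by positivity)] at e2
  rw [e1, e2]
  rcases le_total (y / (Real.sqrt 3 / 2)) (3 / 2) with h | h
  · exact tsum_rhombicTerm_lt_of_le (by linarith) hr h
  · exact tsum_rhombicTerm_lt_of_ge hT h

/-- **Montgomery's theorem**, on the half fundamental domain: the hexagonal point minimizes
the lattice theta function. -/
theorem latticeTheta_hex_lt {t x y : ℝ} (ht : 0 < t) (hx0 : 0 ≤ x) (hx : x ≤ 1 / 2)
    (hy : 0 < y) (hxy : 1 ≤ x ^ 2 + y ^ 2) (hne : (x, y) ≠ (1 / 2, Real.sqrt 3 / 2)) :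
    latticeTheta t (1 / 2) (Real.sqrt 3 / 2) < latticeTheta t x y := by
  have key : ∀ t : ℝ, 1 ≤ t →
      latticeTheta t (1 / 2) (Real.sqrt 3 / 2) < latticeTheta t x y := by
    intro t ht
    have hy2 : 3 / 4 ≤ y ^ 2 := by nlinarith
    have hys : Real.sqrt 3 / 2 ≤ y := by
      have : Real.sqrt 3 ≤ 2 * y := Real.sqrt_le_iff.mpr ⟨by linarith, by nlinarith⟩
      linarith
    rcases hx.lt_or_eq with hlt | rfl
    · have h := latticeTheta_half_lt ht hy hy2 hx0 hlt
      rcases hys.lt_or_eq with hlt' | rfl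
      · exact (latticeTheta_half_lt_half ht hlt').trans h
      · exact h
    · refine latticeTheta_half_lt_half ht (lt_of_le_of_ne hys ?_)
      rintro rfl
      exact hne rfl
  rcases le_total 1 t with h | h
  · exact key t h
  · have h' := key (1 / t) (by rwa [le_div_iff₀ ht, one_mul])
    rw [latticeTheta_one_div _ ht (by positivity), latticeTheta_one_div _ ht hy] at h'
    exact lt_of_mul_lt_mul_left h' ht.le

open MeasureTheory in
lemma lintegral_rpow_mul_exp_neg_mul {a r : ℝ} (ha : 0 < a) (hr : 0 < r) :
    ∫⁻ t in Set.Ioi 0, ENNReal.ofReal (t ^ (a - 1) * Real.exp (-(r * t))) =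
      ENNReal.ofReal ((1 / r) ^ a * Real.Gamma a) := by
  have h := Real.integral_rpow_mul_exp_neg_mul_Ioi ha hr
  have hpos : 0 < (1 / r) ^ a * Real.Gamma a :=
    mul_pos (Real.rpow_pos_of_pos (by positivity) _) (Real.Gamma_pos_of_pos ha)
  have hint : IntegrableOn (fun t : ℝ => t ^ (a - 1) * Real.exp (-(r * t))) (Set.Ioi 0) := by
    by_contra hc
    rw [integral_undef hc] at h
    exact hpos.ne h
  rw [← h, ofReal_integral_eq_lintegral_ofReal hint]
  refine (ae_restrict_mem measurableSet_Ioi).mono fun t ht => ?_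
  exact mul_nonneg (Real.rpow_nonneg (le_of_lt ht) _) (Real.exp_pos _).le

lemma quadForm_pos {x y : ℝ} (hy : 0 < y) {p : ℤ × ℤ} (hp : p ≠ 0) : 0 < quadForm x y p := by
  refine div_pos ?_ hy
  by_cases h : p.2 = 0
  · have h1 : p.1 ≠ 0 := fun h1 => hp (Prod.ext h1 h)
    have : (p.1 : ℝ) ≠ 0 := by exact_mod_cast h1
    rw [h]
    norm_num
    positivity
  · have : (p.2 : ℝ) ≠ 0 := by exact_mod_cast h
    positivity

/-- The Epstein zeta function of the unit co-volume lattice with parameters `x`, `y`. -/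
noncomputable def epsteinSum (s x y : ℝ) : ℝ :=
  ∑' p : {p : ℤ × ℤ // p ≠ 0}, quadForm x y p ^ (-(s / 2))

lemma summable_quadForm_rpow {s : ℝ} (hs : 2 < s) (x : ℝ) {y : ℝ} (hy : 0 < y) :
    Summable fun p : {p : ℤ × ℤ // p ≠ 0} => quadForm x y p ^ (-(s / 2)) := by
  let z : UpperHalfPlane := ⟨⟨x, y⟩, hy⟩
  have h1 : Summable fun v : Fin 2 → ℤ => ‖(v 0 : ℂ) * z + v 1‖ ^ (-s) :=
    Summable.of_nonneg_of_le (fun v => Real.rpow_nonneg (norm_nonneg _) _)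
      (EisensteinSeries.summand_bound z (by linarith))
      ((EisensteinSeries.summable_one_div_norm_rpow hs).mul_left _)
  have h2 : Summable fun p : ℤ × ℤ => y ^ (s / 2) * ‖(p.2 : ℂ) * z + p.1‖ ^ (-s) := by
    refine Summable.mul_left _ ?_
    have := ((finTwoArrowEquiv ℤ).trans (Equiv.prodComm ℤ ℤ)).symm.summable_iff.mpr h1
    simpa [Function.comp_def] using this
  refine (h2.comp_injective Subtype.val_injective).congr fun p => ?_
  obtain ⟨p, hp⟩ := p
  have h3 : quadForm x y p = ‖(p.2 : ℂ) * z + p.1‖ ^ 2 / y := by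
    rw [← Complex.normSq_eq_norm_sq, Complex.normSq_apply, quadForm]
    simp [z]
    ring
  simp only [Function.comp_apply, h3]
  rw [Real.div_rpow (by positivity) hy.le, ← Real.rpow_natCast, ← Real.rpow_mul (norm_nonneg _),
    Real.rpow_neg hy.le, div_inv_eq_mul, mul_comm]
  congr 2
  push_cast
  ring

lemma tsum_ne_zero_exp_quadForm {t : ℝ} (ht : 0 < t) (x : ℝ) {y : ℝ} (hy : 0 < y) (c : ℝ)
    (hc : 0 ≤ c) :
    ∑' p : {p : ℤ × ℤ // p ≠ 0},
      ENNReal.ofReal (c * Real.exp (-(Real.pi * quadForm x y p * t))) =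
      ENNReal.ofReal (c * (latticeTheta t x y - 1)) := by
  have hs := summable_latticeTheta x ht hy
  have hs' : Summable fun p : {p : ℤ × ℤ // p ≠ 0} =>
      Real.exp (-(Real.pi * t * quadForm x y p)) := hs.comp_injective Subtype.val_injective
  have h1 : latticeTheta t x y - 1 =
      ∑' p : {p : ℤ × ℤ // p ≠ 0}, Real.exp (-(Real.pi * t * quadForm x y p)) := by
    have h0 : quadForm x y 0 = 0 := by simp [quadForm]
    rw [latticeTheta, hs.tsum_eq_add_tsum_ite 0, h0, mul_zero, neg_zero, Real.exp_zero,
      add_sub_cancel_left]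
    refine Eq.trans ?_ (tsum_subtype {p : ℤ × ℤ | p ≠ 0}
      fun p => Real.exp (-(Real.pi * t * quadForm x y p))).symm
    refine tsum_congr fun p => ?_
    by_cases hp : p = 0 <;> simp [hp]
  rw [h1, ← tsum_mul_left, ENNReal.ofReal_tsum_of_nonneg (fun p => by positivity)
    (hs'.mul_left c)]
  refine tsum_congr fun p => ?_
  rw [mul_right_comm]

lemma measurable_rpow_mul_exp (a r : ℝ) :
    Measurable fun t : ℝ => ENNReal.ofReal (t ^ (a - 1) * Real.exp (-(r * t))) := by
  fun_prop

open MeasureTheory in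
lemma lintegral_tsum_exp_quadForm {s : ℝ} (hs : 2 < s) (x : ℝ) {y : ℝ} (hy : 0 < y) :
    ∫⁻ t in Set.Ioi 0, ∑' p : {p : ℤ × ℤ // p ≠ 0},
      ENNReal.ofReal (t ^ (s / 2 - 1) * Real.exp (-(Real.pi * quadForm x y p * t))) =
      ENNReal.ofReal ((1 / Real.pi) ^ (s / 2) * Real.Gamma (s / 2) * epsteinSum s x y) := by
  have hΓ : 0 < Real.Gamma (s / 2) := Real.Gamma_pos_of_pos (by linarith)
  rw [lintegral_tsum fun p => (measurable_rpow_mul_exp _ _).aemeasurable, epsteinSum,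
    ← tsum_mul_left, ENNReal.ofReal_tsum_of_nonneg _ ((summable_quadForm_rpow hs x hy).mul_left _)]
  · refine tsum_congr fun p => ?_
    have hq := quadForm_pos (x := x) hy p.2
    rw [lintegral_rpow_mul_exp_neg_mul (by linarith) (by positivity), one_div, mul_inv,
      Real.mul_rpow (by positivity) (by positivity), Real.inv_rpow hq.le, Real.rpow_neg hq.le,
      one_div]
    congr 1
    ring
  · intro p
    have hq := (quadForm_pos (x := x) hy p.2).le
    have := Real.rpow_nonneg hq (-(s / 2))
    positivity

open MeasureTheory in
lemma epsteinSum_hex_lt {s x y : ℝ} (hs : 2 < s) (hx0 : 0 ≤ x) (hx : x ≤ 1 / 2)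
    (hy : 0 < y) (hxy : 1 ≤ x ^ 2 + y ^ 2) (hne : (x, y) ≠ (1 / 2, Real.sqrt 3 / 2)) :
    epsteinSum s (1 / 2) (Real.sqrt 3 / 2) < epsteinSum s x y := by
  have hy3 : (0 : ℝ) < Real.sqrt 3 / 2 := by positivity
  have hΓ : 0 < (1 / Real.pi) ^ (s / 2) * Real.Gamma (s / 2) :=
    mul_pos (Real.rpow_pos_of_pos (by positivity) _) (Real.Gamma_pos_of_pos (by linarith))
  have h1 := lintegral_tsum_exp_quadForm hs (1 / 2) hy3
  have h2 := lintegral_tsum_exp_quadForm hs x hy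
  have key := setLIntegral_strict_mono (μ := volume) (s := Set.Ioi (0 : ℝ)) measurableSet_Ioi
    (by simp)
    (Measurable.tsum fun p : {p : ℤ × ℤ // p ≠ 0} =>
      measurable_rpow_mul_exp (s / 2) (Real.pi * quadForm x y p))
    (h1.trans_ne ENNReal.ofReal_ne_top)
    (Filter.Eventually.of_forall fun t ht => by
      have ht : 0 < t := ht
      have hc : 0 < t ^ (s / 2 - 1) := Real.rpow_pos_of_pos ht _
      rw [tsum_ne_zero_exp_quadForm ht _ hy3 _ hc.le, tsum_ne_zero_exp_quadForm ht _ hy _ hc.le]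
      have hlt := latticeTheta_hex_lt ht hx0 hx hy hxy hne
      have hone : 1 ≤ latticeTheta t (1 / 2) (Real.sqrt 3 / 2) := by
        have := (summable_latticeTheta (1 / 2) ht hy3).sum_le_tsum {0}
          (fun p _ => (Real.exp_pos _).le)
        simpa [quadForm, latticeTheta] using this
      refine (ENNReal.ofReal_lt_ofReal_iff (mul_pos hc (by linarith))).mpr ?_
      exact mul_lt_mul_of_pos_left (by linarith) hc)
  rw [h1, h2] at key
  exact lt_of_mul_lt_mul_left (ENNReal.ofReal_lt_ofReal_iff'.mp key).1 hΓ.le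

/-- In the basis `(u, v)`, the squared norm is the unimodular form with parameters `x`, `y`. -/
def HasForm (u v : EuclideanSpace ℝ (Fin 2)) (x y : ℝ) : Prop :=
  ∀ a b : ℝ, ‖a • u + b • v‖ ^ 2 = ((a + b * x) ^ 2 + (b * y) ^ 2) / y

lemma norm_sq_smul_add_smul (u v : EuclideanSpace ℝ (Fin 2)) (a b : ℝ) :
    ‖a • u + b • v‖ ^ 2 = (a * u 0 + b * v 0) ^ 2 + (a * u 1 + b * v 1) ^ 2 := by
  simp [EuclideanSpace.norm_sq_eq, Fin.sum_univ_two]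

lemma exists_hasForm {u v : EuclideanSpace ℝ (Fin 2)} (h : |det2 u v| = 1) :
    ∃ x y, 0 < y ∧ HasForm u v x y := by
  have hd : (u 0 * v 1 - u 1 * v 0) ^ 2 = 1 := by
    rw [← sq_abs, ← det2, h, one_pow]
  have hN : 0 < u 0 ^ 2 + u 1 ^ 2 := by
    by_contra! hc
    have h0 : u 0 = 0 := by nlinarith [sq_nonneg (u 0), sq_nonneg (u 1)]
    have h1 : u 1 = 0 := by nlinarith [sq_nonneg (u 0), sq_nonneg (u 1)]
    rw [h0, h1] at hd
    norm_num at hd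
  refine ⟨(u 0 * v 0 + u 1 * v 1) / (u 0 ^ 2 + u 1 ^ 2), 1 / (u 0 ^ 2 + u 1 ^ 2),
    by positivity, fun a b => ?_⟩
  rw [norm_sq_smul_add_smul]
  field_simp
  linear_combination b ^ 2 * hd

lemma HasForm.neg {u v : EuclideanSpace ℝ (Fin 2)} {x y : ℝ} (h : HasForm u v x y) :
    HasForm u (-v) (-x) y := by
  intro a b
  have := h a (-b)
  rw [smul_neg, ← neg_smul, this]
  ring

lemma latticeSet_neg (u v : EuclideanSpace ℝ (Fin 2)) : latticeSet u (-v) = latticeSet u v := by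
  ext p
  constructor <;> rintro ⟨m, n, rfl⟩ <;> exact ⟨m, -n, by simp⟩

lemma latticeSet_unimodular (u v : EuclideanSpace ℝ (Fin 2)) {a b c d : ℤ}
    (h : a * d - b * c = 1) :
    latticeSet ((d : ℝ) • u + (c : ℝ) • v) ((b : ℝ) • u + (a : ℝ) • v) = latticeSet u v := by
  have hR : (a : ℝ) * d - b * c = 1 := by exact_mod_cast h
  ext p
  constructor
  · rintro ⟨m, n, rfl⟩
    refine ⟨m * d + n * b, m * c + n * a, ?_⟩
    push_cast
    module
  · rintro ⟨m, n, rfl⟩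
    refine ⟨m * a - n * b, n * d - m * c, ?_⟩
    push_cast
    have hu : (m : ℝ) = (m * a - n * b) * d + (n * d - m * c) * b := by
      linear_combination (-(m : ℝ)) * hR
    have hv : (n : ℝ) = (m * a - n * b) * c + (n * d - m * c) * a := by
      linear_combination (-(n : ℝ)) * hR
    conv_lhs => rw [hu, hv]
    module

lemma HasForm.exists_reduced {u v : EuclideanSpace ℝ (Fin 2)} {x y : ℝ} (hy : 0 < y)
    (h : HasForm u v x y) :
    ∃ (u' v' : EuclideanSpace ℝ (Fin 2)) (x' y' : ℝ), latticeSet u' v' = latticeSet u v ∧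
      HasForm u' v' x' y' ∧ 0 < y' ∧ |x'| ≤ 1 / 2 ∧ 1 ≤ x' ^ 2 + y' ^ 2 := by
  let z : UpperHalfPlane := ⟨⟨x, y⟩, hy⟩
  obtain ⟨g, hg⟩ := ModularGroup.exists_smul_mem_fd z
  have hdet : g 0 0 * g 1 1 - g 0 1 * g 1 0 = 1 := by
    rw [← Matrix.det_fin_two]
    exact g.2
  refine ⟨_, _, (g • z).re, (g • z).im, latticeSet_unimodular u v hdet, fun a b => ?_,
    (g • z).im_pos, hg.2, ?_⟩
  · have e1 : (a * (g 1 1 : ℝ) + b * g 0 1 : ℝ) • u + (a * (g 1 0 : ℝ) + b * g 0 0 : ℝ) • v =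
      a • ((g 1 1 : ℝ) • u + (g 1 0 : ℝ) • v) + b • ((g 0 1 : ℝ) • u + (g 0 0 : ℝ) • v) := by
      module
    rw [← e1, h]
    have hw := UpperHalfPlane.coe_specialLinearGroup_apply g z
    have hden : ((algebraMap ℤ ℝ (g 1 0) : ℝ) : ℂ) * z +
        ((algebraMap ℤ ℝ (g 1 1) : ℝ) : ℂ) ≠ 0 := by
      intro h0
      have := (g • z).im_pos
      rw [← UpperHalfPlane.coe_im, hw, h0, div_zero, Complex.zero_im] at this
      exact this.false
    rw [eq_div_iff hden] at hw
    have hre := congrArg Complex.re hw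
    have him := congrArg Complex.im hw
    simp only [eq_intCast, Complex.ofReal_intCast, Complex.mul_re, Complex.add_re,
      Complex.intCast_re, Complex.intCast_im, Complex.mul_im, Complex.add_im,
      UpperHalfPlane.coe_re, UpperHalfPlane.coe_im] at hre him
    have hx : z.re = x := rfl
    have hy' : z.im = y := rfl
    rw [hx, hy'] at hre him
    have hY := (g • z).im_pos
    generalize (g • z).re = X at hre him
    generalize (g • z).im = Y at hre him hY
    have hdetR : (g 0 0 : ℝ) * g 1 1 - g 0 1 * g 1 0 = 1 := by exact_mod_cast hdet
    generalize (g 0 0 : ℝ) = A at *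
    generalize (g 0 1 : ℝ) = B at *
    generalize (g 1 0 : ℝ) = C at *
    generalize (g 1 1 : ℝ) = D at *
    have f1 : X * (C * x + D) - Y * (C * y) = A * x + B := by linarith
    have f2 : X * (C * y) + Y * (C * x + D) = A * y := by linarith
    have f3 : Y * ((C * x + D) ^ 2 + (C * y) ^ 2) = y := by
      linear_combination (C * x + D) * f2 - C * y * f1 + y * hdetR
    have e2 : a * D + b * B + (a * C + b * A) * x =
        (a + b * X) * (C * x + D) - b * Y * (C * y) := by linear_combination (-b) * f1
    have e3 : (a * C + b * A) * y = (a + b * X) * (C * y) + b * Y * (C * x + D) := by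
      linear_combination (-b) * f2
    rw [e2, e3, div_eq_div_iff hy.ne' hY.ne']
    linear_combination ((a + b * X) ^ 2 + (b * Y) ^ 2) * f3
  · have := hg.1
    rw [Complex.normSq_apply, UpperHalfPlane.coe_re, UpperHalfPlane.coe_im] at this
    linarith

lemma HasForm.epsteinZeta_eq {u v : EuclideanSpace ℝ (Fin 2)} {x y : ℝ} (hy : 0 < y)
    (h : HasForm u v x y) (s : ℝ) : epsteinZeta (latticeSet u v) s = epsteinSum s x y := by
  have hq (p : ℤ × ℤ) : ‖(p.1 : ℝ) • u + (p.2 : ℝ) • v‖ ^ 2 = quadForm x y p := h _ _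
  have hne (p : ℤ × ℤ) (hp : p ≠ 0) : (p.1 : ℝ) • u + (p.2 : ℝ) • v ≠ 0 := by
    intro h0
    have := quadForm_pos (x := x) hy hp
    rw [← hq, h0] at this
    norm_num at this
  let φ : {p : ℤ × ℤ // p ≠ 0} → ↥(latticeSet u v \ {0}) := fun p =>
    ⟨(p.1.1 : ℝ) • u + (p.1.2 : ℝ) • v, ⟨p.1.1, p.1.2, rfl⟩, hne p.1 p.2⟩
  have hφ : Function.Bijective φ := by
    constructor
    · rintro ⟨p, hp⟩ ⟨q, hq'⟩ hpq
      have hpq' : (p.1 : ℝ) • u + (p.2 : ℝ) • v = (q.1 : ℝ) • u + (q.2 : ℝ) • v :=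
        congrArg Subtype.val hpq
      by_contra hc
      refine hne (p - q) (fun h0 => hc (Subtype.ext (sub_eq_zero.mp h0))) ?_
      rw [← sub_eq_zero] at hpq'
      rw [← hpq', Prod.fst_sub, Prod.snd_sub]
      push_cast
      module
    · rintro ⟨w, ⟨m, n, rfl⟩, hw⟩
      refine ⟨⟨(m, n), ?_⟩, rfl⟩
      rintro h0
      obtain ⟨rfl, rfl⟩ := Prod.mk.inj h0
      simp at hw
  rw [epsteinZeta, epsteinSum, ← (Equiv.ofBijective φ hφ).tsum_eq]
  refine tsum_congr fun p => ?_
  rw [← hq, ← Real.rpow_natCast, ← Real.rpow_mul (norm_nonneg _)]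
  congr 1
  push_cast
  ring

lemma hasForm_triangular :
    HasForm (Real.sqrt (2 / Real.sqrt 3) • vec2 1 0)
      (Real.sqrt (2 / Real.sqrt 3) • vec2 (1 / 2) (Real.sqrt 3 / 2)) (1 / 2) (Real.sqrt 3 / 2) := by
  intro a b
  have h : Real.sqrt (2 / Real.sqrt 3) ^ 2 = 2 / Real.sqrt 3 := Real.sq_sqrt (by positivity)
  rw [norm_sq_smul_add_smul]
  simp only [vec2, PiLp.smul_apply, WithLp.equiv_symm_apply, smul_eq_mul, Matrix.cons_val_zero,
    Matrix.cons_val_one]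
  calc _ = Real.sqrt (2 / Real.sqrt 3) ^ 2 *
        ((a + b * (1 / 2)) ^ 2 + (b * (Real.sqrt 3 / 2)) ^ 2) := by ring
    _ = _ := by
      rw [h]
      field_simp

lemma HasForm.linearIndependent {u v : EuclideanSpace ℝ (Fin 2)} {x y : ℝ} (hy : 0 < y)
    (h : HasForm u v x y) : LinearIndependent ℝ ![u, v] := by
  rw [LinearIndependent.pair_iff]
  intro a b hab
  have h1 := h a b
  rw [hab, norm_zero, eq_div_iff hy.ne'] at h1
  have hb : b * y = 0 := by nlinarith [sq_nonneg (a + b * x), sq_nonneg (b * y)]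
  have hb' : b = 0 := (mul_eq_zero.mp hb).resolve_right hy.ne'
  subst hb'
  refine ⟨?_, rfl⟩
  nlinarith

lemma HasForm.isRotationOf {u v u' v' : EuclideanSpace ℝ (Fin 2)} {x y : ℝ} (hy : 0 < y)
    (h : HasForm u v x y) (h' : HasForm u' v' x y) :
    IsRotationOf (latticeSet u v) (latticeSet u' v') := by
  have hcard : Fintype.card (Fin 2) = Module.finrank ℝ (EuclideanSpace ℝ (Fin 2)) := by simp
  let B := basisOfLinearIndependentOfCardEqFinrank (h'.linearIndependent hy) hcard
  let C := basisOfLinearIndependentOfCardEqFinrank (h.linearIndependent hy) hcard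
  let e := B.equiv C (Equiv.refl _)
  have heu : e u' = u := by
    simpa [B, C] using B.equiv_apply 0 C (Equiv.refl _)
  have hev : e v' = v := by
    simpa [B, C] using B.equiv_apply 1 C (Equiv.refl _)
  have hlin (a b : ℝ) : e (a • u' + b • v') = a • u + b • v := by
    rw [map_add, map_smul, map_smul, heu, hev]
  refine ⟨⟨e, fun w => ?_⟩, ?_⟩
  · have hw : w = B.repr w 0 • u' + B.repr w 1 • v' := by
      conv_lhs => rw [← B.sum_repr w]
      simp [B, Fin.sum_univ_two]
    rw [hw, hlin]
    exact (sq_eq_sq₀ (norm_nonneg _) (norm_nonneg _)).mp ((h _ _).trans (h' _ _).symm)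
  · ext w
    constructor
    · rintro ⟨m, n, rfl⟩
      exact ⟨_, ⟨m, n, rfl⟩, hlin _ _⟩
    · rintro ⟨_, ⟨m, n, rfl⟩, rfl⟩
      exact ⟨m, n, hlin _ _⟩

lemma IsRotationOf.epsteinZeta_eq {L L' : Set (EuclideanSpace ℝ (Fin 2))}
    (h : IsRotationOf L L') (s : ℝ) : epsteinZeta L s = epsteinZeta L' s := by
  obtain ⟨O, rfl⟩ := h
  have himg : O '' L' \ {0} = O '' (L' \ {0}) := by
    rw [Set.image_sdiff O.injective, Set.image_singleton, map_zero]
  rw [epsteinZeta, epsteinZeta, himg, tsum_image (fun p => ‖p‖ ^ (-s)) O.injective.injOn]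
  simp

/-- Optimality of the triangular lattice for the Epstein zeta function: for every `s > 2`,
`A₂` is the unique minimizer, up to rotation, of `L ↦ ζ_L(s)` among lattices of co-volume 1. -/
theorem epsteinZeta_triangular_minimality
    (s : ℝ) (hs : 2 < s) :
    ∀ L : Set (EuclideanSpace ℝ (Fin 2)), IsLattice2OfCovol L 1 →
      epsteinZeta triangularLattice s ≤ epsteinZeta L s ∧
      (epsteinZeta L s = epsteinZeta triangularLattice s ↔
        IsRotationOf L triangularLattice) := by
  rintro L ⟨u₀, v₀, -, hdet, rfl⟩
  obtain ⟨x₀, y₀, hy₀, h₀⟩ := exists_hasForm hdet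
  obtain ⟨u, v, x, y, hL, h, hy, hx, hx0, hxy⟩ : ∃ (u v : EuclideanSpace ℝ (Fin 2)) (x y : ℝ),
      latticeSet u v = latticeSet u₀ v₀ ∧ HasForm u v x y ∧ 0 < y ∧ x ≤ 1 / 2 ∧ 0 ≤ x ∧
        1 ≤ x ^ 2 + y ^ 2 := by
    obtain ⟨u, v, x, y, hL, h, hy, hx, hxy⟩ := h₀.exists_reduced hy₀
    rcases le_total 0 x with hx0 | hx0
    · exact ⟨u, v, x, y, hL, h, hy, (abs_le.mp hx).2, hx0, hxy⟩
    · exact ⟨u, -v, -x, y, (latticeSet_neg u v).trans hL, h.neg, hy,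
        by linarith [(abs_le.mp hx).1], by linarith, by simpa using hxy⟩
  have hy3 : (0 : ℝ) < Real.sqrt 3 / 2 := by positivity
  have hA : epsteinZeta triangularLattice s = epsteinSum s (1 / 2) (Real.sqrt 3 / 2) :=
    hasForm_triangular.epsteinZeta_eq hy3 s
  rw [← hL]
  by_cases hne : (x, y) = (1 / 2, Real.sqrt 3 / 2)
  · obtain ⟨rfl, rfl⟩ := Prod.mk.inj hne
    have hrot : IsRotationOf (latticeSet u v) triangularLattice :=
      h.isRotationOf hy3 hasForm_triangular
    have heq := hrot.epsteinZeta_eq s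
    exact ⟨heq.ge, fun _ => hrot, fun _ => heq⟩
  · have hlt := epsteinSum_hex_lt hs hx0 hx hy hxy hne
    rw [← hA, ← h.epsteinZeta_eq hy] at hlt
    exact ⟨hlt.le, fun heq => absurd heq hlt.ne', fun hrot => hrot.epsteinZeta_eq s⟩
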